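/- arXiv:1003.4482 — 2 statements merged into one kernel-verified Lean document; each statement's English description precedes it below -/
import Mathlib

section
/- The number of p×q matrices with nonnegative integer entries, row sums λ and column sums μ, equals the sum over all partitions σ of n of the product K_{σλ}·K_{σμ} of Kostka numbers. -/
open Finset Equiv
open scoped Classical

noncomputable section

/-- Value at `g` of the permutation character of `S_n` induced from the trivial character of
the Young subgroup of the composition `c`: the number of colorings of `Fin n` with fiber
sizes given by `c` that are fixed by `g`. -/
def permChar (n : ℕ) (c : ℕ → ℕ) (g : Perm (Fin n)) : ℚ :=
  Nat.card {f : Fin n → ℕ // (∀ k, Nat.card {x : Fin n // f x = k} = c k) ∧ ∀ x, f (g x) = f x}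

/-- Inner product of class functions (real-valued characters) of `S_n`. -/
def innerChar (n : ℕ) (χ ψ : Perm (Fin n) → ℚ) : ℚ :=
  (∑ g : Perm (Fin n), χ g * ψ g) / (n.factorial : ℚ)

/-- The trivial character `χ^{(n)}` of `S_n`. -/
def trivChar (n : ℕ) : Perm (Fin n) → ℚ := fun _ => 1

/-- The sign character `χ^{(1^n)}` of `S_n`. -/
def signChar (n : ℕ) : Perm (Fin n) → ℚ := fun g => ((Perm.sign g : ℤ) : ℚ)

/-- Permutation character for an integer vector: zero if some entry is negative. -/
def permCharZ (n : ℕ) (c : ℕ → ℤ) (g : Perm (Fin n)) : ℚ :=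
  if ∀ k, 0 ≤ c k then permChar n (fun k => (c k).toNat) g else 0

/-- The irreducible character `χ^a` of `S_n` indexed by the partition `a`, given by the
Jacobi–Trudi determinantal formula `χ^a = ∑_σ sgn(σ) φ^{(a_i - i + σ(i))_i}`. -/
def irrChar (n : ℕ) (a : ℕ → ℕ) (g : Perm (Fin n)) : ℚ :=
  ∑ σ : Perm (Fin n), ((Perm.sign σ : ℤ) : ℚ) *
    permCharZ n (fun i => if h : i < n then (a i : ℤ) - i + ((σ ⟨i, h⟩ : Fin n) : ℕ) else 0) g

/-- Kronecker coefficient `k(a,b,c) = ⟨χ^a ⊗ χ^b, χ^c⟩`. -/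
def kron (n : ℕ) (a b c : ℕ → ℕ) : ℚ :=
  innerChar n (fun g => irrChar n a g * irrChar n b g) (irrChar n c)

/-- Extend a vector indexed by `Fin p` to `ℕ` by zeros. -/
def extc {p : ℕ} (l : Fin p → ℕ) : ℕ → ℕ := fun i => if h : i < p then l ⟨i, h⟩ else 0

/-- Dominance order: `a ⊵ b`. -/
def Dominates (a b : ℕ → ℕ) : Prop :=
  ∀ k, ∑ i ∈ Finset.range k, b i ≤ ∑ i ∈ Finset.range k, a i

/-- Conjugate (transpose) of a partition with at most `n` parts. -/
def conjFun (n : ℕ) (a : ℕ → ℕ) : ℕ → ℕ :=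
  fun j => ((Finset.range n).filter (fun i => j < a i)).card

/-- `a` is a partition of `n` (weakly decreasing, supported on the first `n` parts). -/
def IsPartitionFun (n : ℕ) (a : ℕ → ℕ) : Prop :=
  (∀ i j, i ≤ j → a j ≤ a i) ∧ (∀ i, n ≤ i → a i = 0) ∧ ∑ i ∈ Finset.range n, a i = n

/-- The weakly decreasing sequence of parts of `P : Nat.Partition n`. -/
def pf {n : ℕ} (P : n.Partition) : ℕ → ℕ :=
  fun i => ((P.parts.sort (· ≤ ·)).reverse).getD i 0

/-- The parts of `P : Nat.Partition n` as a vector of length `n`. -/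
def pfin {n : ℕ} (P : n.Partition) : Fin n → ℕ := fun k => pf P k

/-- Number of cells of the skew shape `a/b` where the filling `T` has entry `k`. -/
def skewContent (a b : ℕ → ℕ) (T : ℕ → ℕ → ℕ) (k : ℕ) : ℕ :=
  Nat.card {p : ℕ × ℕ // b p.1 ≤ p.2 ∧ p.2 < a p.1 ∧ T p.1 p.2 = k}

/-- Number of cells of the skew shape `a/b`. -/
def skewSize (a b : ℕ → ℕ) : ℕ :=
  Nat.card {p : ℕ × ℕ // b p.1 ≤ p.2 ∧ p.2 < a p.1}

/-- `T` is a semistandard filling of the shape `a` (zero outside, rows weakly increasing,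
columns strictly increasing). -/
def IsSSYT (a : ℕ → ℕ) (T : ℕ → ℕ → ℕ) : Prop :=
  (∀ i j, a i ≤ j → T i j = 0) ∧
  (∀ i j₁ j₂, j₁ ≤ j₂ → j₂ < a i → T i j₁ ≤ T i j₂) ∧
  (∀ i₁ i₂ j, i₁ < i₂ → j < a i₂ → T i₁ j < T i₂ j)

/-- The Kostka number: the number of semistandard Young tableaux of shape `a`
and content `c`. -/
def kostka (a c : ℕ → ℕ) : ℕ :=
  Nat.card {T : ℕ → ℕ → ℕ // IsSSYT a T ∧ ∀ k, skewContent a (fun _ => 0) T k = c k}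

/-- Number of entries equal to `k` in the prefix of the (right-to-left, top-to-bottom)
reading word of `T` ending at position `(i,j)`. -/
def lrCount (a b : ℕ → ℕ) (T : ℕ → ℕ → ℕ) (i j k : ℕ) : ℕ :=
  Nat.card {p : ℕ × ℕ //
    (p.1 < i ∨ (p.1 = i ∧ j ≤ p.2)) ∧ b p.1 ≤ p.2 ∧ p.2 < a p.1 ∧ T p.1 p.2 = k}

/-- `T` is a Littlewood–Richardson skew tableau of shape `a/b`: semistandard and its
reverse reading word is a lattice word. -/
def IsLR (a b : ℕ → ℕ) (T : ℕ → ℕ → ℕ) : Prop :=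
  (∀ i j, ¬(b i ≤ j ∧ j < a i) → T i j = 0) ∧
  (∀ i j₁ j₂, b i ≤ j₁ → j₁ ≤ j₂ → j₂ < a i → T i j₁ ≤ T i j₂) ∧
  (∀ i₁ i₂ j, i₁ < i₂ → b i₁ ≤ j → j < a i₁ → b i₂ ≤ j → j < a i₂ → T i₁ j < T i₂ j) ∧
  (∀ i j k, lrCount a b T i j (k + 1) ≤ lrCount a b T i j k)

/-- A Littlewood–Richardson multitableau of shape `α` with `r` parts: a chain of
partitions `0 = α(0) ⊆ α(1) ⊆ ⋯ ⊆ α(r) = α` together with Littlewood–Richardson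
fillings of the successive skew shapes. -/
structure LRMultiF (r : ℕ) (α : ℕ → ℕ) where
  chain : Fin (r + 1) → ℕ → ℕ
  antitone : ∀ k i j, i ≤ j → chain k j ≤ chain k i
  zero : ∀ i, chain 0 i = 0
  last : ∀ i, chain (Fin.last r) i = α i
  mono : ∀ (k : Fin r) (i : ℕ), chain k.castSucc i ≤ chain k.succ i
  T : Fin r → ℕ → ℕ → ℕ
  lr : ∀ k : Fin r, IsLR (chain k.succ) (chain k.castSucc) (T k)

/-- Content of the `k`-th tableau of a Littlewood–Richardson multitableau. -/
def LRMultiF.cont {r : ℕ} {α : ℕ → ℕ} (M : LRMultiF r α) (k : Fin r) : ℕ → ℕ :=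
  skewContent (M.chain k.succ) (M.chain k.castSucc) (M.T k)

/-- Size of the `k`-th tableau of a Littlewood–Richardson multitableau. -/
def LRMultiF.size {r : ℕ} {α : ℕ → ℕ} (M : LRMultiF r α) (k : Fin r) : ℕ :=
  skewSize (M.chain k.succ) (M.chain k.castSucc)

/-- `LR(α,β;ν)`: pairs of Littlewood–Richardson multitableaux of shapes `α`, `β`,
type `ν`, with equal contents. -/
def LRPairs (r : ℕ) (α β : ℕ → ℕ) (ν : Fin r → ℕ) :=
  {TS : LRMultiF r α × LRMultiF r β //
    (∀ k, TS.1.size k = ν k) ∧ (∀ k, TS.2.size k = ν k) ∧ ∀ k, TS.1.cont k = TS.2.cont k}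

/-- `LR*(α,β;ν)`: pairs of Littlewood–Richardson multitableaux of shapes `α`, `β`,
type `ν`, with termwise conjugate contents. -/
def LRPairsStar (n r : ℕ) (α β : ℕ → ℕ) (ν : Fin r → ℕ) :=
  {TS : LRMultiF r α × LRMultiF r β //
    (∀ k, TS.1.size k = ν k) ∧ (∀ k, TS.2.size k = ν k) ∧
      ∀ k m, TS.2.cont k m = conjFun n (TS.1.cont k) m}

/-- `lr(α,β;ν)`. -/
def lrNum (r : ℕ) (α β : ℕ → ℕ) (ν : Fin r → ℕ) : ℕ := Nat.card (LRPairs r α β ν)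

/-- `lr*(α,β;ν)`. -/
def lrStarNum (n r : ℕ) (α β : ℕ → ℕ) (ν : Fin r → ℕ) : ℕ :=
  Nat.card (LRPairsStar n r α β ν)

/-- A semistandard Young tableau (of arbitrary partition shape). -/
structure SSYTP where
  shape : ℕ → ℕ
  T : ℕ → ℕ → ℕ
  antitone : ∀ i j, i ≤ j → shape j ≤ shape i
  finite : ∃ N, ∀ i, N ≤ i → shape i = 0
  ssyt : IsSSYT shape T

/-- Content of a semistandard Young tableau. -/
def SSYTP.cont (P : SSYTP) : ℕ → ℕ := skewContent P.shape (fun _ => 0) P.T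

/-- The multiset of entries of a matrix. -/
def entriesM {p q : ℕ} (A : Fin p → Fin q → ℕ) : Multiset ℕ :=
  (Finset.univ : Finset (Fin p × Fin q)).val.map (fun ij => A ij.1 ij.2)

/-- The π-sequence of `A` is the partition `ν` (the weakly decreasing rearrangement of
the entries of `A` is `ν`). -/
def HasPiSeq {p q : ℕ} (A : Fin p → Fin q → ℕ) {n : ℕ} (ν : n.Partition) : Prop :=
  (entriesM A).filter (· ≠ 0) = ν.parts

end

/-- The Iverson bracket of a proposition, with values in `ℝ≥0∞`. -/
noncomputable def iverson (P : Prop) : ENNReal := if P then 1 else 0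

theorem iverson_true {P : Prop} (h : P) : iverson P = 1 := if_pos h

theorem iverson_false {P : Prop} (h : ¬P) : iverson P = 0 := if_neg h

theorem iverson_and (P Q : Prop) : iverson (P ∧ Q) = iverson P * iverson Q := by
  by_cases hP : P <;> by_cases hQ : Q <;> simp [iverson, hP, hQ]

theorem tsum_iverson {X : Type*} (P : X → Prop) :
    ∑' x, iverson (P x) = ENat.card {x // P x} := by
  rw [← ENNReal.tsum_one]
  refine Eq.trans ?_ (tsum_subtype {x | P x} fun _ => (1 : ENNReal)).symm
  refine tsum_congr fun x => ?_
  by_cases h : P x <;> simp [iverson, h]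

theorem tsum_iverson_congr {X Y : Type*} {P : X → Prop} {Q : Y → Prop}
    (e : {x // P x} ≃ {y // Q y}) : ∑' x, iverson (P x) = ∑' y, iverson (Q y) := by
  rw [tsum_iverson, tsum_iverson, ENat.card_congr e]

/-- `γ / δ` is a horizontal strip of size `a`. For `δ` and `γ` interlacing in this sense both
are automatically weakly decreasing. -/
def IsHorizontalStrip (a : ℕ) (δ γ : ℕ →₀ ℕ) : Prop :=
  (∀ i, δ i ≤ γ i ∧ γ (i + 1) ≤ δ i) ∧ γ.degree = δ.degree + a

/-- Remove the first part. -/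
noncomputable def shiftDown (x : ℕ →₀ ℕ) : ℕ →₀ ℕ :=
  x.comapDomain Nat.succ Nat.succ_injective.injOn

/-- Insert a new first part. -/
noncomputable def shiftUp (k : ℕ) (x : ℕ →₀ ℕ) : ℕ →₀ ℕ :=
  Finsupp.single 0 k + x.mapDomain Nat.succ

@[simp] theorem shiftDown_apply (x : ℕ →₀ ℕ) (i : ℕ) : shiftDown x i = x (i + 1) := rfl

@[simp] theorem shiftUp_zero (k : ℕ) (x : ℕ →₀ ℕ) : shiftUp k x 0 = k := by
  simp [shiftUp, Finsupp.mapDomain_of_notMem_range]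

@[simp] theorem shiftUp_succ (k : ℕ) (x : ℕ →₀ ℕ) (i : ℕ) : shiftUp k x (i + 1) = x i := by
  have := Finsupp.mapDomain_apply Nat.succ_injective x i
  simpa [shiftUp] using this

theorem shiftUp_shiftDown (x : ℕ →₀ ℕ) : shiftUp (x 0) (shiftDown x) = x := by
  ext i
  cases i <;> simp

theorem degree_shiftUp (k : ℕ) (x : ℕ →₀ ℕ) : (shiftUp k x).degree = k + x.degree := by
  have : (x.mapDomain Nat.succ).degree = x.degree := by
    rw [Finsupp.degree_apply, Finsupp.degree_apply,
      Finsupp.mapDomain_support_of_injective Nat.succ_injective,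
      Finset.sum_image Nat.succ_injective.injOn]
    exact Finset.sum_congr rfl fun i _ => Finsupp.mapDomain_apply Nat.succ_injective x i
  simp [shiftUp, this]

theorem degree_shiftDown (x : ℕ →₀ ℕ) : x.degree = x 0 + (shiftDown x).degree := by
  rw [← degree_shiftUp, shiftUp_shiftDown]

theorem degree_sup_add_degree_inf (x y : ℕ →₀ ℕ) :
    (x ⊔ y).degree + (x ⊓ y).degree = x.degree + y.degree := by
  rw [← map_add, ← map_add]
  congr 1
  ext i
  simp only [Finsupp.add_apply, Finsupp.sup_apply, Finsupp.inf_apply]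
  exact max_add_min _ _

/-- The centre of the local rule: `γ (i + 1)` and `δ i` are reflections of one another in an
interval depending on `α` and `β`, whose endpoints sum to this value. -/
noncomputable def reflectSum (α β : ℕ →₀ ℕ) : ℕ →₀ ℕ := α ⊓ β + shiftDown (α ⊔ β)

theorem reflectSum_apply (α β : ℕ →₀ ℕ) (i : ℕ) :
    reflectSum α β i = min (α i) (β i) + max (α (i + 1)) (β (i + 1)) := rfl

theorem degree_reflectSum (α β : ℕ →₀ ℕ) :
    (reflectSum α β).degree + max (α 0) (β 0) = α.degree + β.degree := by
  have h := degree_sup_add_degree_inf α β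
  have h' := degree_shiftDown (α ⊔ β)
  rw [reflectSum, map_add]
  simp only [Finsupp.sup_apply] at h'
  change (α ⊔ β).degree = max (α 0) (β 0) + _ at h'
  omega

theorem degree_tsub_add {x y : ℕ →₀ ℕ} (h : ∀ i, y i ≤ x i) :
    (x - y).degree + y.degree = x.degree := by
  rw [← map_add, tsub_add_cancel_of_le (show y ≤ x from h)]

/-- Fomin's local rule. -/
noncomputable def localRule (a b : ℕ) (α β : ℕ →₀ ℕ) :
    {γ : ℕ →₀ ℕ // IsHorizontalStrip b α γ ∧ IsHorizontalStrip a β γ} ≃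
      {x : ℕ × (ℕ →₀ ℕ) // (x.1 ≤ a ∧ x.1 ≤ b) ∧
        IsHorizontalStrip (b - x.1) x.2 β ∧ IsHorizontalStrip (a - x.1) x.2 α} where
  toFun γ := ⟨(γ.1 0 - max (α 0) (β 0), reflectSum α β - shiftDown γ.1), by
    obtain ⟨γ, ⟨hα, dα⟩, hβ, dβ⟩ := γ
    have hs : ∀ i, shiftDown γ i ≤ reflectSum α β i := fun i => by
      have := hα i; have := hβ i
      rw [reflectSum_apply, shiftDown_apply]; omega
    have d1 := degree_tsub_add hs
    have d2 := degree_reflectSum α β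
    have d3 := degree_shiftDown γ
    have hi : ∀ i, (reflectSum α β - shiftDown γ) i =
      min (α i) (β i) + max (α (i + 1)) (β (i + 1)) - γ (i + 1) := fun i => rfl
    have dle : (reflectSum α β - shiftDown γ).degree ≤ α.degree ∧
        (reflectSum α β - shiftDown γ).degree ≤ β.degree := by
      constructor <;> refine Finsupp.degree_mono fun i => ?_ <;> rw [hi] <;>
        have := hα (i + 1) <;> have := hβ (i + 1) <;> have := hα i <;> have := hβ i <;> omega
    have := hα 0
    have := hβ 0
    refine ⟨⟨?_, ?_⟩, ⟨fun i => ?_, ?_⟩, fun i => ?_, ?_⟩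
    · dsimp only; omega
    · dsimp only; omega
    · dsimp only
      rw [hi]
      have := hα (i + 1); have := hβ (i + 1); have := hα i; have := hβ i
      omega
    · dsimp only; omega
    · dsimp only
      rw [hi]
      have := hα (i + 1); have := hβ (i + 1); have := hα i; have := hβ i
      omega
    · dsimp only; omega⟩
  invFun x := ⟨shiftUp (max (α 0) (β 0) + x.1.1) (reflectSum α β - x.1.2), by
    obtain ⟨⟨k, δ⟩, ⟨ka, kb⟩, hsβ, hsα⟩ := x
    have hβ : ∀ i, δ i ≤ β i ∧ β (i + 1) ≤ δ i := hsβ.1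
    have hα : ∀ i, δ i ≤ α i ∧ α (i + 1) ≤ δ i := hsα.1
    have dβ : β.degree = δ.degree + (b - k) := hsβ.2
    have dα : α.degree = δ.degree + (a - k) := hsα.2
    have ka : k ≤ a := ka
    have kb : k ≤ b := kb
    dsimp only
    have hs : ∀ i, δ i ≤ reflectSum α β i := fun i => by
      have := hα i; have := hβ i
      rw [reflectSum_apply]; omega
    have d1 := degree_tsub_add hs
    have d2 := degree_reflectSum α β
    have d3 := degree_shiftUp (max (α 0) (β 0) + k) (reflectSum α β - δ)
    have hi : ∀ i, (reflectSum α β - δ) i =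
      min (α i) (β i) + max (α (i + 1)) (β (i + 1)) - δ i := fun i => rfl
    refine ⟨⟨fun i => ?_, by omega⟩, fun i => ?_, by omega⟩
    all_goals
      cases i with
      | zero =>
        rw [shiftUp_succ, shiftUp_zero, hi]
        have := hα 0; have := hβ 0
        omega
      | succ i =>
        rw [shiftUp_succ, shiftUp_succ, hi, hi]
        have := hα (i + 1); have := hβ (i + 1); have := hα i; have := hβ i
        omega⟩
  left_inv := by
    rintro ⟨γ, ⟨hα, dα⟩, hβ, dβ⟩
    refine Subtype.ext (Finsupp.ext fun i => ?_)
    dsimp only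
    cases i with
    | zero =>
      rw [shiftUp_zero]
      have := hα 0; have := hβ 0
      omega
    | succ i =>
      rw [shiftUp_succ]
      change reflectSum α β i - (reflectSum α β i - γ (i + 1)) = _
      rw [reflectSum_apply]
      have := hα i; have := hβ i
      omega
  right_inv := by
    rintro ⟨⟨k, δ⟩, -, ⟨hβ, -⟩, hα, -⟩
    refine Subtype.ext (Prod.ext ?_ (Finsupp.ext fun i => ?_))
    · dsimp only
      rw [shiftUp_zero]
      omega
    · change reflectSum α β i - shiftUp _ (reflectSum α β - δ) (i + 1) = _
      rw [shiftUp_succ]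
      change reflectSum α β i - (reflectSum α β i - δ i) = _
      rw [reflectSum_apply]
      have := hα i; have := hβ i
      dsimp only at *
      omega

theorem tsum_localRule (a b : ℕ) (α β : ℕ →₀ ℕ) :
    ∑' γ, iverson (IsHorizontalStrip b α γ) * iverson (IsHorizontalStrip a β γ) =
      ∑' k : ℕ, ∑' δ, iverson (k ≤ a ∧ k ≤ b) *
        (iverson (IsHorizontalStrip (b - k) δ β) * iverson (IsHorizontalStrip (a - k) δ α)) := by
  simp only [← iverson_and]
  rw [tsum_iverson_congr (localRule a b α β)]
  exact ENNReal.tsum_prod (f := fun k δ => iverson ((k ≤ a ∧ k ≤ b) ∧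
    IsHorizontalStrip (b - k) δ β ∧ IsHorizontalStrip (a - k) δ α))

/-- The number of chains of horizontal strips from the empty partition to `γ` whose
successive sizes are given by `l`. -/
noncomputable def stripChains : (p : ℕ) → (Fin p → ℕ) → (ℕ →₀ ℕ) → ENNReal
  | 0, _, γ => iverson (γ = 0)
  | p + 1, l, γ =>
    ∑' δ, iverson (IsHorizontalStrip (l (Fin.last p)) δ γ) * stripChains p (Fin.init l) δ

theorem isHorizontalStrip_zero_right {a : ℕ} {δ : ℕ →₀ ℕ} :
    IsHorizontalStrip a δ 0 ↔ δ = 0 ∧ a = 0 := by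
  constructor
  · rintro ⟨h, d⟩
    rw [map_zero] at d
    exact ⟨(Finsupp.degree_eq_zero_iff δ).1 (by omega), by omega⟩
  · rintro ⟨rfl, rfl⟩
    exact ⟨by simp, by simp⟩

theorem stripChains_zero_right (p : ℕ) (l : Fin p → ℕ) :
    stripChains p l 0 = iverson (∀ i, l i = 0) := by
  induction p with
  | zero => simp [stripChains, iverson]
  | succ p ih =>
    rw [stripChains, tsum_eq_single 0]
    · rw [ih, ← iverson_and, isHorizontalStrip_zero_right, Fin.forall_fin_succ']
      congr 1
      simp [Fin.init, and_comm]
    · intro δ hδ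
      rw [iverson_false, zero_mul]
      rw [isHorizontalStrip_zero_right]
      exact fun h => hδ h.1

theorem stripChains_ne_zero (p : ℕ) (l : Fin p → ℕ) (γ : ℕ →₀ ℕ) (h : stripChains p l γ ≠ 0) :
    (∀ i, γ (i + 1) ≤ γ i) ∧ γ.degree = ∑ i, l i := by
  induction p generalizing γ with
  | zero =>
    have : γ = 0 := by
      by_contra h0
      exact h (iverson_false h0)
    simp [this]
  | succ p ih =>
    rw [stripChains, ne_eq, ENNReal.tsum_eq_zero, not_forall] at h
    obtain ⟨δ, hδ⟩ := h
    rw [mul_eq_zero, not_or] at hδ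
    have hs : IsHorizontalStrip (l (Fin.last p)) δ γ := by
      by_contra h0
      exact hδ.1 (iverson_false h0)
    refine ⟨fun i => (hs.1 i).2.trans (hs.1 i).1, ?_⟩
    rw [hs.2, (ih _ _ hδ.2).2, Fin.sum_univ_castSucc]
    rfl

theorem tsum_snoc {p : ℕ} {X : Type} (f : (Fin (p + 1) → X) → ENNReal) :
    ∑' c, f c = ∑' (k : X) (c : Fin p → X), f (Fin.snoc c k) := by
  rw [← ENNReal.tsum_prod (f := fun (k : X) (c : Fin p → X) => f (Fin.snoc c k))]
  exact ((Fin.snocEquiv fun _ : Fin (p + 1) => X).tsum_eq f).symm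

theorem tsum_strip_stripChains (p : ℕ) (l : Fin p → ℕ) (b : ℕ) (α : ℕ →₀ ℕ) :
    ∑' γ, iverson (IsHorizontalStrip b α γ) * stripChains p l γ =
      ∑' c : Fin p → ℕ, iverson ((∀ i, c i ≤ l i) ∧ ∑ i, c i = b) *
        stripChains p (fun i => l i - c i) α := by
  induction p generalizing b α with
  | zero =>
    rw [tsum_eq_single 0, tsum_eq_single 0]
    · simp only [stripChains, ← iverson_and]
      congr 1
      simp [isHorizontalStrip_zero_right, and_comm, eq_comm]
    · intro c hc
      exact (hc (Subsingleton.elim _ _)).elim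
    · intro γ hγ
      simp [stripChains, iverson_false hγ]
  | succ p ih =>
    calc ∑' γ, iverson (IsHorizontalStrip b α γ) * stripChains (p + 1) l γ
        = ∑' β, stripChains p (Fin.init l) β * ∑' γ, iverson (IsHorizontalStrip b α γ) *
            iverson (IsHorizontalStrip (l (Fin.last p)) β γ) := by
          simp only [stripChains, ← ENNReal.tsum_mul_left]
          rw [ENNReal.tsum_comm]
          exact tsum_congr fun _ => tsum_congr fun _ => by ring
      _ = ∑' k : ℕ, ∑' δ, iverson (k ≤ l (Fin.last p) ∧ k ≤ b) *
            iverson (IsHorizontalStrip (l (Fin.last p) - k) δ α) *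
            ∑' β, iverson (IsHorizontalStrip (b - k) δ β) * stripChains p (Fin.init l) β := by
          simp only [tsum_localRule, ← ENNReal.tsum_mul_left]
          rw [ENNReal.tsum_comm]
          refine tsum_congr fun k => ?_
          rw [ENNReal.tsum_comm]
          exact tsum_congr fun _ => tsum_congr fun _ => by ring
      _ = _ := by
          rw [tsum_snoc]
          refine tsum_congr fun k => ?_
          simp only [ih, stripChains, ← ENNReal.tsum_mul_left]
          rw [ENNReal.tsum_comm]
          refine tsum_congr fun c => tsum_congr fun δ => ?_
          have h1 : (Fin.init fun i => l i - (Fin.snoc c k : Fin (p + 1) → ℕ) i) =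
              fun i => Fin.init l i - c i := by
            ext i
            simp [Fin.init]
          simp only [h1, Fin.snoc_last, Fin.forall_fin_succ', Fin.sum_univ_castSucc,
            Fin.snoc_castSucc]
          rw [← mul_assoc, ← mul_assoc]
          congr 1
          rw [mul_right_comm]
          congr 1
          rw [← iverson_and]
          congr 1
          refine propext ⟨?_, ?_⟩
          · rintro ⟨⟨h1, h2⟩, h3, h4⟩
            exact ⟨⟨h3, h1⟩, by omega⟩
          · rintro ⟨⟨h1, h2⟩, h3⟩
            exact ⟨⟨h2, by omega⟩, h1, by omega⟩

theorem tsum_stripChains_mul_stripChains (p q : ℕ) (l : Fin p → ℕ) (m : Fin q → ℕ) :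
    ∑' γ, stripChains p l γ * stripChains q m γ =
      ∑' A : Fin q → Fin p → ℕ, iverson ((∀ i, ∑ j, A j i = l i) ∧ ∀ j, ∑ i, A j i = m j) := by
  induction q generalizing l with
  | zero =>
    rw [tsum_eq_single 0, tsum_eq_single 0, stripChains_zero_right]
    · simp [stripChains, iverson, eq_comm]
    · intro c hc
      exact (hc (Subsingleton.elim _ _)).elim
    · intro γ hγ
      simp [stripChains, iverson_false hγ]
  | succ q ih =>
    calc ∑' γ, stripChains p l γ * stripChains (q + 1) m γ
        = ∑' α, stripChains q (Fin.init m) α *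
            ∑' γ, iverson (IsHorizontalStrip (m (Fin.last q)) α γ) * stripChains p l γ := by
          simp only [stripChains, ← ENNReal.tsum_mul_left]
          rw [ENNReal.tsum_comm]
          exact tsum_congr fun _ => tsum_congr fun _ => by ring
      _ = ∑' c : Fin p → ℕ, iverson ((∀ i, c i ≤ l i) ∧ ∑ i, c i = m (Fin.last q)) *
            ∑' α, stripChains p (fun i => l i - c i) α * stripChains q (Fin.init m) α := by
          simp only [tsum_strip_stripChains, ← ENNReal.tsum_mul_left]
          rw [ENNReal.tsum_comm]
          exact tsum_congr fun _ => tsum_congr fun _ => by ring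
      _ = _ := by
          rw [tsum_snoc]
          refine tsum_congr fun c => ?_
          rw [ih, ← ENNReal.tsum_mul_left]
          refine tsum_congr fun A => ?_
          rw [← iverson_and]
          congr 1
          simp only [Fin.forall_fin_succ', Fin.sum_univ_castSucc, Fin.snoc_last, Fin.snoc_castSucc]
          refine propext ⟨?_, ?_⟩
          · rintro ⟨⟨h1, h2⟩, h3, h4⟩
            exact ⟨fun i => by have := h1 i; have := h3 i; omega, h4, h2⟩
          · rintro ⟨h1, h2, h3⟩
            exact ⟨⟨fun i => by have := h1 i; omega, h3⟩, fun i => by have := h1 i; omega, h2⟩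

/-- The cells of the Young diagram with row lengths `γ`. -/
noncomputable def cells (γ : ℕ →₀ ℕ) : Finset (ℕ × ℕ) :=
  γ.support.biUnion fun i => {i} ×ˢ Finset.range (γ i)

theorem mem_cells {γ : ℕ →₀ ℕ} {x : ℕ × ℕ} : x ∈ cells γ ↔ x.2 < γ x.1 := by
  simp only [cells, Finset.mem_biUnion, Finsupp.mem_support_iff, Finset.mem_product,
    Finset.mem_singleton, Finset.mem_range]
  constructor
  · rintro ⟨i, -, rfl, h⟩
    exact h
  · intro h
    exact ⟨x.1, by omega, rfl, h⟩

theorem card_cells (γ : ℕ →₀ ℕ) : (cells γ).card = γ.degree := by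
  rw [cells, Finset.card_biUnion]
  · simp [Finsupp.degree_apply]
  · intro i _ j _ hij
    rw [Function.onFun, Finset.disjoint_left]
    rintro ⟨a, b⟩ h1 h2
    simp only [Finset.mem_product, Finset.mem_singleton] at h1 h2
    exact hij (h1.1.symm.trans h2.1)

theorem skewContent_eq_card (γ : ℕ →₀ ℕ) (T : ℕ → ℕ → ℕ) (k : ℕ) :
    skewContent γ (fun _ => 0) T k = ((cells γ).filter fun x => T x.1 x.2 = k).card := by
  refine Nat.subtype_card _ fun x => ?_
  simp [mem_cells]

/-- `T` is a semistandard tableau of shape `γ` and content `l`. -/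
def IsTableau (p : ℕ) (l : Fin p → ℕ) (γ : ℕ →₀ ℕ) (T : ℕ → ℕ → ℕ) : Prop :=
  IsSSYT γ T ∧ ∀ k, skewContent γ (fun _ => 0) T k = extc l k

theorem IsTableau.lt {p : ℕ} {l : Fin p → ℕ} {γ : ℕ →₀ ℕ} {T : ℕ → ℕ → ℕ}
    (h : IsTableau p l γ T) {i j : ℕ} (hj : j < γ i) : T i j < p := by
  by_contra hp
  have h0 := h.2 (T i j)
  rw [skewContent_eq_card, extc, dif_neg hp, Finset.card_eq_zero,
    Finset.filter_eq_empty_iff] at h0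
  exact h0 (x := (i, j)) (mem_cells.2 hj) rfl

theorem extc_init {p : ℕ} (l : Fin (p + 1) → ℕ) {k : ℕ} (hk : k < p) :
    extc (Fin.init l) k = extc l k := by
  rw [extc, extc, dif_pos hk, dif_pos (by omega)]
  rfl

theorem extc_last {p : ℕ} (l : Fin (p + 1) → ℕ) : extc l p = l (Fin.last p) := by
  rw [extc, dif_pos (by omega)]
  rfl

theorem extc_of_le {p : ℕ} (l : Fin p → ℕ) {k : ℕ} (hk : p ≤ k) : extc l k = 0 :=
  dif_neg (by omega)

/-- Extend a filling of `δ` to `γ` by the entry `p`. -/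
noncomputable def extendFilling (p : ℕ) (γ δ : ℕ →₀ ℕ) (T : ℕ → ℕ → ℕ) : ℕ → ℕ → ℕ :=
  fun i j => if j < δ i then T i j else if j < γ i then p else 0

theorem isTableau_extendFilling {p : ℕ} {l : Fin (p + 1) → ℕ} {γ δ : ℕ →₀ ℕ} {T : ℕ → ℕ → ℕ}
    (hγ : Antitone γ) (hs : IsHorizontalStrip (l (Fin.last p)) δ γ)
    (hT : IsTableau p (Fin.init l) δ T) : IsTableau (p + 1) l γ (extendFilling p γ δ T) := by
  have hlt : ∀ {i j}, j < δ i → T i j < p := hT.lt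
  obtain ⟨⟨hT0, hTr, hTc⟩, hc⟩ := hT
  obtain ⟨hi, hd⟩ := hs
  refine ⟨⟨fun i j h => ?_, fun i j₁ j₂ h h' => ?_, fun i₁ i₂ j h h' => ?_⟩, fun k => ?_⟩
  · have := hi i
    rw [extendFilling, if_neg (by omega), if_neg (by omega)]
  · unfold extendFilling
    split_ifs with h1 h2 h3 h4
    · exact hTr i _ _ h h2
    · exact (hlt h1).le
    · omega
    · exact le_rfl
    · omega
    · exact Nat.zero_le _
  · have h1 : γ i₂ ≤ γ (i₁ + 1) := hγ h
    have h2 := hi i₁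
    unfold extendFilling
    rw [if_pos (show j < δ i₁ by omega)]
    split_ifs with h3
    · exact hTc _ _ _ h h3
    · exact hlt (by omega)
  · rw [skewContent_eq_card]
    rcases lt_trichotomy k p with hk | rfl | hk
    · rw [← extc_init l hk, ← hc, skewContent_eq_card]
      congr 1
      ext x
      rw [Finset.mem_filter, Finset.mem_filter, mem_cells, mem_cells]
      unfold extendFilling
      have := hi x.1
      split_ifs <;> constructor <;> rintro ⟨h1, h2⟩ <;> constructor <;> omega
    · have h1 : ((cells γ).filter fun x => extendFilling k γ δ T x.1 x.2 = k) =
          cells γ \ cells δ := by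
        ext x
        rw [Finset.mem_filter, Finset.mem_sdiff, mem_cells, mem_cells]
        unfold extendFilling
        refine and_congr_right fun h => ?_
        split_ifs with h3
        · have := hlt h3
          simp [h3, this.ne]
        · simp [h3]
      rw [h1, Finset.card_sdiff_of_subset, card_cells, card_cells, extc_last]
      · omega
      · intro x
        rw [mem_cells, mem_cells]
        have := hi x.1
        omega
    · rw [extc_of_le l hk, Finset.card_eq_zero, Finset.filter_eq_empty_iff]
      intro x hx
      rw [mem_cells] at hx
      unfold extendFilling
      split_ifs with h3
      · have := hlt h3
        omega
      · omega

theorem lt_iff_extendFilling_lt {p : ℕ} {l : Fin p → ℕ} {γ δ : ℕ →₀ ℕ} {T : ℕ → ℕ → ℕ}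
    {a : ℕ} (hs : IsHorizontalStrip a δ γ) (hT : IsTableau p l δ T) (i j : ℕ) :
    j < δ i ↔ j < γ i ∧ extendFilling p γ δ T i j < p := by
  have := hs.1 i
  unfold extendFilling
  split_ifs with h1 h2
  · have := hT.lt h1
    omega
  · omega
  · omega

theorem extendFilling_injective {p : ℕ} {l : Fin p → ℕ} {γ δ δ' : ℕ →₀ ℕ} {T T' : ℕ → ℕ → ℕ}
    {a : ℕ} (hs : IsHorizontalStrip a δ γ) (hT : IsTableau p l δ T)
    (hs' : IsHorizontalStrip a δ' γ) (hT' : IsTableau p l δ' T')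
    (h : extendFilling p γ δ T = extendFilling p γ δ' T') : δ = δ' ∧ T = T' := by
  have hδ : δ = δ' := by
    ext i
    refine eq_of_forall_lt_iff fun j => ?_
    rw [lt_iff_extendFilling_lt hs hT, lt_iff_extendFilling_lt hs' hT', h]
  subst hδ
  refine ⟨rfl, funext fun i => funext fun j => ?_⟩
  by_cases hj : j < δ i
  · have := congrFun (congrFun h i) j
    simpa [extendFilling, hj] using this
  · rw [hT.1.1 i j (by omega), hT'.1.1 i j (by omega)]

theorem exists_extendFilling_eq {p : ℕ} {l : Fin (p + 1) → ℕ} {γ : ℕ →₀ ℕ} {T : ℕ → ℕ → ℕ}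
    (hγ : Antitone γ) (hT : IsTableau (p + 1) l γ T) :
    ∃ δ T', IsHorizontalStrip (l (Fin.last p)) δ γ ∧ IsTableau p (Fin.init l) δ T' ∧
      extendFilling p γ δ T' = T := by
  have hlt : ∀ {i j}, j < γ i → T i j < p + 1 := hT.lt
  obtain ⟨⟨hT0, hTr, hTc⟩, hc⟩ := hT
  have hex : ∀ i, ∃ j, ¬(j < γ i ∧ T i j < p) := fun i => ⟨γ i, by omega⟩
  have hfind : ∀ i j, j < Nat.find (hex i) ↔ j < γ i ∧ T i j < p := by
    intro i j
    rw [Nat.lt_find_iff]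
    constructor
    · intro h
      exact not_not.1 (h j le_rfl)
    · rintro ⟨h1, h2⟩ k hk
      rw [not_not]
      exact ⟨by omega, (hTr i k j hk h1).trans_lt h2⟩
  have hle : ∀ i, Nat.find (hex i) ≤ γ i := fun i => Nat.find_min' _ (by omega)
  let δ : ℕ →₀ ℕ := Finsupp.onFinset γ.support (fun i => Nat.find (hex i)) fun i hi => by
    have := hle i
    rw [Finsupp.mem_support_iff]
    omega
  have hδ : ∀ i j, j < δ i ↔ j < γ i ∧ T i j < p := hfind
  have hδle : ∀ i, δ i ≤ γ i := hle
  have hsub : cells δ ⊆ cells γ := fun x => by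
    rw [mem_cells, mem_cells]
    have := hδle x.1
    omega
  refine ⟨δ, fun i j => if j < δ i then T i j else 0, ⟨fun i => ⟨hδle i, ?_⟩, ?_⟩,
    ⟨⟨fun i j h => if_neg (by omega), fun i j₁ j₂ h h' => ?_, fun i₁ i₂ j h h' => ?_⟩,
      fun k => ?_⟩, ?_⟩
  · by_contra! h
    have h1 := hTc i (i + 1) (δ i) (by omega) h
    have h2 := hlt h
    have h3 : γ (i + 1) ≤ γ i := hγ (by omega)
    have := (hδ i (δ i)).2 ⟨by omega, by omega⟩
    omega
  · have h1 := hc p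
    have h2 : ((cells γ).filter fun x => T x.1 x.2 = p) = cells γ \ cells δ := by
      ext x
      simp only [Finset.mem_filter, Finset.mem_sdiff, mem_cells, hδ]
      refine and_congr_right fun h => ?_
      have := hlt h
      omega
    rw [skewContent_eq_card, h2, Finset.card_sdiff_of_subset hsub, card_cells, card_cells,
      extc_last] at h1
    have h3 := Finset.card_le_card hsub
    rw [card_cells, card_cells] at h3
    omega
  · dsimp only
    rw [if_pos (by omega), if_pos h']
    exact hTr i _ _ h (by have := hδle i; omega)
  · have h1 := (hδ _ _).1 h'
    have h2 := hTc _ _ _ h h1.1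
    have h3 : γ i₂ ≤ γ i₁ := hγ h.le
    dsimp only
    rw [if_pos h', if_pos ((hδ _ _).2 ⟨by omega, by omega⟩)]
    exact h2
  · rw [skewContent_eq_card]
    by_cases hk : k < p
    · rw [extc_init l hk, ← hc, skewContent_eq_card]
      congr 1
      ext x
      simp only [Finset.mem_filter, mem_cells]
      have := hδ x.1 x.2
      split_ifs with h
      · simp only [h, true_and]
        constructor
        · intro h2
          exact ⟨(this.1 h).1, h2⟩
        · exact fun h2 => h2.2
      · constructor
        · rintro ⟨h1, -⟩
          exact (h h1).elim
        · rintro ⟨h1, h2⟩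
          exact (h (this.2 ⟨h1, by omega⟩)).elim
    · rw [extc_of_le _ (by omega), Finset.card_eq_zero, Finset.filter_eq_empty_iff]
      intro x hx
      rw [mem_cells] at hx
      rw [if_pos hx]
      have := (hδ _ _).1 hx
      omega
  · ext i j
    have h1 := hδ i j
    unfold extendFilling
    split_ifs with h2 h3
    · exact if_pos h2
    · have := hlt h3
      by_contra h4
      exact h2 (h1.2 ⟨h3, by omega⟩)
    · exact (hT0 i j (by omega)).symm

theorem card_isTableau (p : ℕ) (l : Fin p → ℕ) (γ : ℕ →₀ ℕ) (hγ : Antitone γ) :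
    ((ENat.card {T // IsTableau p l γ T} : ℕ∞) : ENNReal) = stripChains p l γ := by
  induction p generalizing γ with
  | zero =>
    rw [stripChains]
    by_cases h0 : γ = 0
    · subst h0
      rw [iverson_true rfl]
      have : Unique {T // IsTableau 0 l 0 T} :=
        { default := ⟨fun _ _ => 0, ⟨by simp, by simp, by simp⟩, fun k => by
            rw [skewContent_eq_card, extc_of_le _ (by omega)]
            simp [cells]⟩
          uniq := fun T => Subtype.ext <| funext fun i => funext fun j =>
            T.2.1.1 i j (Nat.zero_le _) }
      simp
    · rw [iverson_false h0]
      have : IsEmpty {T // IsTableau 0 l γ T} := by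
        refine ⟨fun T => h0 (Finsupp.ext fun i => ?_)⟩
        by_contra h
        exact absurd (T.2.lt (Nat.pos_of_ne_zero h)) (by omega)
      rw [ENat.card_eq_coe_natCard, Nat.card_of_isEmpty]
      simp
  | succ p ih =>
    have key : ∀ δ, iverson (IsHorizontalStrip (l (Fin.last p)) δ γ) *
        stripChains p (Fin.init l) δ = ∑' T, iverson (IsHorizontalStrip (l (Fin.last p)) δ γ ∧
          IsTableau p (Fin.init l) δ T) := by
      intro δ
      simp only [iverson_and, ENNReal.tsum_mul_left]
      by_cases hs : IsHorizontalStrip (l (Fin.last p)) δ γ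
      · have : Antitone δ := antitone_nat_of_succ_le fun i => (hs.1 (i + 1)).1.trans (hs.1 i).2
        rw [← ih _ _ this, ← tsum_iverson]
      · rw [iverson_false hs, zero_mul, zero_mul]
    rw [stripChains, tsum_congr key, ← ENNReal.tsum_prod (f := fun δ T => iverson
      (IsHorizontalStrip (l (Fin.last p)) δ γ ∧ IsTableau p (Fin.init l) δ T)), tsum_iverson]
    refine congrArg _ (ENat.card_congr (Equiv.ofBijective (fun x =>
      ⟨extendFilling p γ x.1.1 x.1.2, isTableau_extendFilling hγ x.2.1 x.2.2⟩) ⟨?_, ?_⟩)).symm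
    · intro x y h
      have := extendFilling_injective x.2.1 x.2.2 y.2.1 y.2.2 (congrArg Subtype.val h)
      exact Subtype.ext (Prod.ext this.1 this.2)
    · rintro ⟨T, hT⟩
      obtain ⟨δ, T', hs, hT', h⟩ := exists_extendFilling_eq hγ hT
      exact ⟨⟨(δ, T'), hs, hT'⟩, Subtype.ext h⟩

theorem toReal_stripChains (p : ℕ) (l : Fin p → ℕ) (γ : ℕ →₀ ℕ) (hγ : Antitone γ) :
    (stripChains p l γ).toReal = kostka γ (extc l) := by
  rw [← card_isTableau p l γ hγ]
  by_cases h : Finite {T // IsTableau p l γ T}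
  · rw [ENat.card_eq_coe_natCard]
    rfl
  · rw [not_finite_iff_infinite] at h
    have : kostka γ (extc l) = 0 := Nat.card_eq_zero_of_infinite (α := {T // IsTableau p l γ T})
    simp [this]

/-- The row lengths of a partition, as a finitely supported function. -/
noncomputable def partitionFinsupp {n : ℕ} (P : n.Partition) : ℕ →₀ ℕ :=
  Finsupp.onFinset (Finset.range (P.parts.sort (· ≤ ·)).reverse.length) (pf P) fun i hi => by
    by_contra h
    rw [Finset.mem_range, not_lt] at h
    exact hi (List.getD_eq_default _ _ h)

theorem support_partitionFinsupp {n : ℕ} (P : n.Partition) :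
    (partitionFinsupp P).support = Finset.range (P.parts.sort (· ≤ ·)).reverse.length := by
  ext i
  rw [Finsupp.mem_support_iff, Finset.mem_range]
  constructor
  · intro hi
    by_contra h
    exact hi (List.getD_eq_default _ _ (not_lt.1 h))
  · intro hi
    have h1 : partitionFinsupp P i = (P.parts.sort (· ≤ ·)).reverse[i] :=
      List.getD_eq_getElem _ _ hi
    have h2 := List.getElem_mem hi
    rw [List.mem_reverse, Multiset.mem_sort] at h2
    rw [h1]
    exact (P.parts_pos h2).ne'

theorem map_support_partitionFinsupp {n : ℕ} (P : n.Partition) :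
    (partitionFinsupp P).support.val.map (partitionFinsupp P) = P.parts := by
  rw [support_partitionFinsupp]
  conv_rhs => rw [← Multiset.sort_eq P.parts (· ≤ ·), ← Multiset.coe_reverse]
  change ((List.range _ : List ℕ) : Multiset ℕ).map _ = _
  rw [Multiset.map_coe]
  congr 1
  refine List.ext_getElem (by simp) fun i h1 h2 => ?_
  rw [List.getElem_map, List.getElem_range]
  exact List.getD_eq_getElem _ _ h2

theorem partitionFinsupp_injective {n : ℕ} :
    Function.Injective (partitionFinsupp : n.Partition → ℕ →₀ ℕ) := by
  intro P Q h
  refine Nat.Partition.ext ?_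
  rw [← map_support_partitionFinsupp, h, map_support_partitionFinsupp]

theorem antitone_partitionFinsupp {n : ℕ} (P : n.Partition) : Antitone (partitionFinsupp P) := by
  intro i j hij
  by_cases hj : j < (P.parts.sort (· ≤ ·)).reverse.length
  · have hi := hij.trans_lt hj
    have h1 : partitionFinsupp P i = (P.parts.sort (· ≤ ·)).reverse[i] :=
      List.getD_eq_getElem _ _ hi
    have h2 : partitionFinsupp P j = (P.parts.sort (· ≤ ·)).reverse[j] :=
      List.getD_eq_getElem _ _ hj
    rw [h1, h2]
    have : (P.parts.sort (· ≤ ·)).reverse.Pairwise (· ≥ ·) :=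
      List.pairwise_reverse.2 (Multiset.pairwise_sort _ _)
    rcases hij.eq_or_lt with rfl | hlt
    · exact le_rfl
    · exact List.pairwise_iff_getElem.1 this _ _ _ _ hlt
  · have h2 : partitionFinsupp P j = 0 := List.getD_eq_default _ _ (not_lt.1 hj)
    omega

theorem exists_partitionFinsupp_eq {n : ℕ} {γ : ℕ →₀ ℕ} (hγ : Antitone γ) (hn : γ.degree = n) :
    ∃ P : n.Partition, partitionFinsupp P = γ := by
  have hsupp : γ.support = Finset.range γ.support.card := by
    refine Finset.eq_of_subset_of_card_le (fun i hi => ?_) (by simp)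
    rw [Finset.mem_range]
    have : Finset.range (i + 1) ⊆ γ.support := fun j hj => by
      rw [Finset.mem_range] at hj
      rw [Finsupp.mem_support_iff] at hi ⊢
      have := hγ (show j ≤ i by omega)
      omega
    have := Finset.card_le_card this
    rw [Finset.card_range] at this
    omega
  let P : n.Partition :=
    { parts := γ.support.val.map γ
      parts_pos := fun {i} hi => by
        obtain ⟨j, hj, rfl⟩ := Multiset.mem_map.1 hi
        exact Nat.pos_of_ne_zero (Finsupp.mem_support_iff.1 hj)
      parts_sum := hn }
  have hlist : (P.parts.sort (· ≤ ·)).reverse = (List.range γ.support.card).map γ := by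
    refine List.Perm.eq_of_pairwise (le := (· ≥ ·)) (fun a b _ _ h1 h2 => le_antisymm h2 h1)
      (List.pairwise_reverse.2 (Multiset.pairwise_sort _ _)) ?_ ?_
    · rw [List.pairwise_map]
      exact List.pairwise_lt_range.imp fun h => hγ h.le
    · rw [← Multiset.coe_eq_coe, Multiset.coe_reverse, Multiset.sort_eq, ← Multiset.map_coe]
      change γ.support.val.map γ = _
      conv_lhs => rw [hsupp]
      rfl
  refine ⟨P, Finsupp.ext fun i => ?_⟩
  change (P.parts.sort (· ≤ ·)).reverse.getD i 0 = γ i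
  rw [hlist]
  by_cases hi : i < γ.support.card
  · rw [List.getD_eq_getElem _ _ (by simpa using hi)]
    simp
  · rw [List.getD_eq_default _ _ (by simpa using hi)]
    have : i ∉ γ.support := by
      rw [hsupp, Finset.mem_range]
      exact hi
    exact (Finsupp.notMem_support_iff.1 this).symm

theorem finite_matrices {p q : ℕ} (l : Fin p → ℕ) (m : Fin q → ℕ) :
    Finite {A : Fin q → Fin p → ℕ // (∀ i, ∑ j, A j i = l i) ∧ ∀ j, ∑ i, A j i = m j} := by
  refine (Set.finite_Iic (fun (_ : Fin q) (i : Fin p) => l i)).subset ?_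
  rintro A ⟨hA, -⟩ j i
  dsimp only
  rw [← hA i]
  exact Finset.single_le_sum (f := fun j => A j i) (fun _ _ => Nat.zero_le _) (Finset.mem_univ j)

/-- the number of `p × q` nonnegative integer matrices with row sums `l` and
column sums `m` equals `∑_{σ ⊢ n} K_{σl} K_{σm}`. -/
theorem stmt2 (n p q : ℕ) (l : Fin p → ℕ) (m : Fin q → ℕ)
    (hl : ∑ i, l i = n) (hm : ∑ j, m j = n) :
    Nat.card {A : Fin p → Fin q → ℕ //
        (∀ i, ∑ j, A i j = l i) ∧ (∀ j, ∑ i, A i j = m j)} =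
      ∑ σ : n.Partition, kostka (pf σ) (extc l) * kostka (pf σ) (extc m) := by
  have := finite_matrices l m
  have hcard : Nat.card {A : Fin p → Fin q → ℕ //
        (∀ i, ∑ j, A i j = l i) ∧ (∀ j, ∑ i, A i j = m j)} =
      Nat.card {A : Fin q → Fin p → ℕ //
        (∀ i, ∑ j, A j i = l i) ∧ ∀ j, ∑ i, A j i = m j} :=
    Nat.card_congr ((Equiv.piComm fun _ _ => ℕ).subtypeEquiv fun A => Iff.rfl)
  have hsum := tsum_stripChains_mul_stripChains p q l m
  rw [tsum_iverson, ENat.card_eq_coe_natCard, ← hcard,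
    ← (partitionFinsupp_injective (n := n)).tsum_eq, tsum_fintype] at hsum
  · have hne : ∀ σ ∈ (Finset.univ : Finset n.Partition),
        stripChains p l (partitionFinsupp σ) * stripChains q m (partitionFinsupp σ) ≠ ⊤ := by
      refine ENNReal.sum_ne_top.1 ?_
      rw [hsum]
      simp
    have h := congrArg ENNReal.toReal hsum
    rw [ENNReal.toReal_sum hne] at h
    simp only [ENNReal.toReal_mul, toReal_stripChains _ _ _ (antitone_partitionFinsupp _)] at h
    simp only [ENat.toENNReal_coe, ENNReal.toReal_natCast] at h
    exact_mod_cast h.symm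
  · intro γ hγ
    have h := stripChains_ne_zero p l γ (left_ne_zero_of_mul hγ)
    exact exists_partitionFinsupp_eq (antitone_nat_of_succ_le h.1) (h.2.trans hl)
end

section
/- The number of p×q matrices with entries in {0,1}, row sums λ and column sums μ, equals the sum over all partitions σ of n of the product K_{σλ}·K_{σ'μ}, where σ' is the conjugate partition of σ. -/
open Finset Equiv
open scoped Classical

namespace YoungDiagram

/-- `γ / δ` is a horizontal strip: `δ` is contained in `γ` and no two cells of the difference lie
in the same column. -/
def IsHorizontalStrip (δ γ : YoungDiagram) : Prop :=
  δ ≤ γ ∧ ∀ i j, (i + 1, j) ∈ γ → (i, j) ∈ δ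

/-- `γ / δ` is a vertical strip: `δ` is contained in `γ` and no two cells of the difference lie
in the same row. -/
def IsVerticalStrip (δ γ : YoungDiagram) : Prop :=
  δ ≤ γ ∧ ∀ i j, (i, j + 1) ∈ γ → (i, j) ∈ δ

theorem isHorizontalStrip_transpose {δ γ : YoungDiagram} :
    IsHorizontalStrip δ.transpose γ.transpose ↔ IsVerticalStrip δ γ := by
  simp only [IsHorizontalStrip, IsVerticalStrip, transpose_le_iff, mem_transpose, Prod.swap_prod_mk]
  exact and_congr_right fun _ => forall_comm

theorem le_iff_rowLen_le {δ γ : YoungDiagram} : δ ≤ γ ↔ ∀ i, δ.rowLen i ≤ γ.rowLen i := by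
  constructor
  · intro h i
    by_contra! hlt
    exact absurd (mem_iff_lt_rowLen.1 (h (mem_iff_lt_rowLen.2 hlt))) (lt_irrefl _)
  · rintro h ⟨i, j⟩ hc
    exact mem_iff_lt_rowLen.2 ((mem_iff_lt_rowLen.1 hc).trans_le (h i))

theorem isHorizontalStrip_iff_rowLen {δ γ : YoungDiagram} :
    IsHorizontalStrip δ γ ↔ ∀ i, δ.rowLen i ≤ γ.rowLen i ∧ γ.rowLen (i + 1) ≤ δ.rowLen i := by
  simp only [IsHorizontalStrip, le_iff_rowLen_le, mem_iff_lt_rowLen, forall_and]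
  exact and_congr_right fun _ => forall_congr' fun i => forall_lt_iff_le

theorem isVerticalStrip_iff_rowLen {δ γ : YoungDiagram} :
    IsVerticalStrip δ γ ↔ ∀ i, δ.rowLen i ≤ γ.rowLen i ∧ γ.rowLen i ≤ δ.rowLen i + 1 := by
  simp only [IsVerticalStrip, le_iff_rowLen_le, mem_iff_lt_rowLen, forall_and]
  refine and_congr_right fun _ => forall_congr' fun i => ⟨fun h => ?_, fun h j hj => by omega⟩
  by_contra! hlt
  exact absurd (h (δ.rowLen i) hlt) (lt_irrefl _)

theorem ext_rowLen {δ γ : YoungDiagram} (h : ∀ i, δ.rowLen i = γ.rowLen i) : δ = γ :=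
  le_antisymm (le_iff_rowLen_le.2 fun i => (h i).le) (le_iff_rowLen_le.2 fun i => (h i).ge)

theorem exists_rowLen_eq {f : ℕ → ℕ} (hf : Antitone f) {N : ℕ} (hN : ∀ i, N ≤ i → f i = 0) :
    ∃ γ : YoungDiagram, ∀ i, γ.rowLen i = f i := by
  have hlt {i j : ℕ} (h : j < f i) : i < N ∧ j < f 0 :=
    ⟨by by_contra! hi; have := hN i hi; omega, h.trans_le (hf (Nat.zero_le i))⟩
  let γ : YoungDiagram :=
    { cells := (range N ×ˢ range (f 0)).filter fun c => c.2 < f c.1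
      isLowerSet := by
        rintro ⟨i, j⟩ ⟨i', j'⟩ hle hc
        obtain ⟨hi, hj⟩ := Prod.mk_le_mk.1 hle
        simp only [coe_filter, mem_product, mem_range, Set.mem_ofPred_eq] at hc ⊢
        have : j' < f i' := (hj.trans_lt hc.2).trans_le (hf hi)
        exact ⟨hlt this, this⟩ }
  have hγ (i j : ℕ) : j < γ.rowLen i ↔ j < f i := by
    rw [← mem_iff_lt_rowLen, ← mem_cells, mem_filter]
    simpa using hlt
  exact ⟨γ, fun i => eq_of_forall_lt_iff fun j => hγ i j⟩

theorem card_eq_sum_rowLen (γ : YoungDiagram) {N : ℕ} (hN : ∀ i, N ≤ i → γ.rowLen i = 0) :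
    γ.card = ∑ i ∈ range N, γ.rowLen i := by
  have hmap : ∀ c ∈ γ.cells, c.1 ∈ range N := by
    rintro ⟨i, j⟩ hc
    have hj := mem_iff_lt_rowLen.1 hc
    rw [mem_range]
    by_contra! hi
    have := hN i hi
    omega
  rw [YoungDiagram.card, card_eq_sum_card_fiberwise hmap]
  exact sum_congr rfl fun i _ => (rowLen_eq_card γ).symm

theorem card_sub_card {δ γ : YoungDiagram} (h : δ ≤ γ) {N : ℕ}
    (hN : ∀ i, N ≤ i → γ.rowLen i = 0) :
    γ.card - δ.card = ∑ i ∈ range N, (γ.rowLen i - δ.rowLen i) := by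
  have hle := le_iff_rowLen_le.1 h
  rw [card_eq_sum_rowLen γ hN,
    card_eq_sum_rowLen δ fun i hi => Nat.le_zero.1 ((hle i).trans (hN i hi).le),
    Finset.sum_tsub_distrib _ fun i _ => hle i]

theorem rowLen_eq_zero_iff {γ : YoungDiagram} {i : ℕ} : γ.rowLen i = 0 ↔ γ.colLen 0 ≤ i := by
  rw [← not_lt, ← mem_iff_lt_colLen, mem_iff_lt_rowLen]
  omega

end YoungDiagram

/-- Local identity behind the commutation of horizontal and vertical strips. -/
theorem strip_weight_comm {R : Type*} [CommSemiring R] (x y : R) {a b u b' : ℕ}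
    (hu : a ≤ u) (hb : b' ≤ b) :
    (∑ c ∈ ({b, b + 1} : Finset ℕ).filter (fun c => a ≤ c ∧ c ≤ u), x ^ (c - a) * y ^ (c - b)) *
        ((if b' ≤ a then 1 else 0) + if b' < a then x * y else 0) =
      ((if b ≤ u then 1 else 0) + if b < u then x * y else 0) *
        ∑ c ∈ ({a - 1, a} : Finset ℕ).filter (fun c => b' ≤ c ∧ c ≤ b),
          x ^ (b - c) * y ^ (a - c) := by
  rw [sum_filter, sum_filter, sum_pair (Nat.succ_ne_self b).symm]
  rcases Nat.eq_zero_or_pos a with rfl | ha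
  · have h1 : b < u ↔ b + 1 ≤ u := Iff.rfl
    have h2 : b + 1 - 0 = (b - 0) + 1 := by omega
    simp only [Nat.zero_sub, pair_eq_singleton, sum_singleton, h1, h2]
    split_ifs <;> first | omega | (simp; try ring)
  · rw [sum_pair (by omega)]
    rcases lt_trichotomy a (b + 1) with h | rfl | h
    · obtain ⟨k, rfl⟩ := Nat.exists_eq_add_of_le (Nat.lt_succ_iff.1 h)
      have h1 : a + k - (a - 1) = k + 1 := by omega
      have h2 : a + k + 1 - a = k + 1 := by omega
      have h3 : a - (a - 1) = 1 := by omega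
      simp only [h1, h2, h3]
      split_ifs <;> first | omega | (simp; try ring)
    · split_ifs <;> first | omega | (simp; try ring)
    · split_ifs <;> first | omega | simp

theorem strip_weight_prod_comm {R : Type*} [CommSemiring R] (x y : R) {a b u : ℕ → ℕ}
    (hb : Antitone b) (ha : ∀ i, a i ≤ u i) (hu : ∀ i, u (i + 1) = a i) (N : ℕ) :
    (∏ i ∈ range N, ∑ c ∈ ({b i, b i + 1} : Finset ℕ).filter (fun c => a i ≤ c ∧ c ≤ u i),
        x ^ (c - a i) * y ^ (c - b i)) *
          ((if b N ≤ u N then 1 else 0) + if b N < u N then x * y else 0) =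
      ((if b 0 ≤ u 0 then 1 else 0) + if b 0 < u 0 then x * y else 0) *
        ∏ i ∈ range N, ∑ c ∈ ({a i - 1, a i} : Finset ℕ).filter
          (fun c => b (i + 1) ≤ c ∧ c ≤ b i), x ^ (b i - c) * y ^ (a i - c) := by
  induction N with
  | zero => simp
  | succ N ih =>
    rw [prod_range_succ, prod_range_succ, ← mul_assoc, ← ih, mul_assoc, mul_assoc, hu,
      strip_weight_comm x y (ha N) (hb N.le_succ)]

namespace YoungDiagram

/-- Summing a product of row weights over the diagrams whose row lengths range independently over
given sets. -/
theorem sum_prod_rowLen {R : Type*} [CommSemiring R] {M : ℕ} {t : ℕ → Finset ℕ}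
    (ht : ∀ i, i + 1 < M → ∀ c ∈ t i, ∀ c' ∈ t (i + 1), c' ≤ c) (w : ℕ → ℕ → R)
    {B : Finset YoungDiagram}
    (hB : ∀ γ, γ ∈ B ↔ (∀ i < M, γ.rowLen i ∈ t i) ∧ ∀ i, M ≤ i → γ.rowLen i = 0) :
    ∑ γ ∈ B, ∏ i ∈ range M, w i (γ.rowLen i) = ∏ i ∈ range M, ∑ c ∈ t i, w i c := by
  rw [prod_range, prod_univ_sum]
  refine sum_nbij (fun γ i => γ.rowLen i) ?_ ?_ ?_ ?_
  · intro γ hγ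
    exact Fintype.mem_piFinset.2 fun i => ((hB γ).1 hγ).1 i i.2
  · intro γ hγ γ' hγ' h
    refine ext_rowLen fun i => ?_
    rcases lt_or_ge i M with hi | hi
    · exact congrFun h ⟨i, hi⟩
    · rw [((hB γ).1 hγ).2 i hi, ((hB γ').1 hγ').2 i hi]
  · intro f hf
    have hf := Fintype.mem_piFinset.1 (mem_coe.1 hf)
    obtain ⟨γ, hγ⟩ := exists_rowLen_eq (f := fun i => if h : i < M then f ⟨i, h⟩ else 0) (N := M)
      (antitone_nat_of_succ_le fun i => by
        by_cases hi : i + 1 < M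
        · simpa only [hi, (Nat.lt_succ_self i).trans hi, dif_pos] using
            ht i hi _ (hf ⟨i, _⟩) _ (hf ⟨i + 1, hi⟩)
        · simp [hi])
      (fun i hi => dif_neg hi.not_gt)
    refine ⟨γ, (hB γ).2 ⟨fun i hi => ?_, fun i hi => ?_⟩, funext fun i => ?_⟩
    · rw [hγ, dif_pos hi]
      exact hf ⟨i, hi⟩
    · rw [hγ, dif_neg hi.not_gt]
    · simp [hγ]
  · intro γ _
    exact prod_range _

theorem sum_strips_comm {R : Type*} [CommSemiring R] (x y : R) {α β : YoungDiagram}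
    {B B' : Finset YoungDiagram}
    (hB : ∀ γ, IsHorizontalStrip α γ → IsVerticalStrip β γ → γ ∈ B)
    (hB' : ∀ δ, IsHorizontalStrip δ β → IsVerticalStrip δ α → δ ∈ B') :
    ∑ γ ∈ B with IsHorizontalStrip α γ ∧ IsVerticalStrip β γ,
        x ^ (γ.card - α.card) * y ^ (γ.card - β.card) =
      (1 + x * y) * ∑ δ ∈ B' with IsHorizontalStrip δ β ∧ IsVerticalStrip δ α,
        x ^ (β.card - δ.card) * y ^ (α.card - δ.card) := by
  obtain ⟨N, hα, hβ⟩ : ∃ N, (∀ i, N ≤ i → α.rowLen i = 0) ∧ ∀ i, N ≤ i → β.rowLen i = 0 :=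
    ⟨max (α.colLen 0) (β.colLen 0),
      fun i hi => rowLen_eq_zero_iff.2 ((le_max_left _ _).trans hi),
      fun i hi => rowLen_eq_zero_iff.2 ((le_max_right _ _).trans hi)⟩
  have hα' := fun i (hi : N + 1 ≤ i) => hα i (by omega)
  have hβ' := fun i (hi : N + 1 ≤ i) => hβ i (by omega)
  let u : ℕ → ℕ := fun i => Nat.casesOn i (α.rowLen 0 + β.rowLen 0 + 1) α.rowLen
  have hu0 : u 0 = α.rowLen 0 + β.rowLen 0 + 1 := rfl
  have hu (i : ℕ) : u (i + 1) = α.rowLen i := rfl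
  have hαu (i : ℕ) : α.rowLen i ≤ u i := by
    cases i with
    | zero => rw [hu0]; omega
    | succ i => exact α.rowLen_anti _ _ i.le_succ
  have key := strip_weight_prod_comm x y (b := β.rowLen) β.rowLen_anti hαu hu (N + 1)
  rw [hu, hα N le_rfl, hβ' _ le_rfl] at key
  have h0 : β.rowLen 0 < u 0 := by rw [hu0]; omega
  simp only [le_refl, if_true, lt_irrefl, if_false, add_zero, mul_one, h0, h0.le] at key
  rw [← sum_prod_rowLen (B := {γ ∈ B | IsHorizontalStrip α γ ∧ IsVerticalStrip β γ}),
    ← sum_prod_rowLen (B := {δ ∈ B' | IsHorizontalStrip δ β ∧ IsVerticalStrip δ α})] at key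
  · refine Eq.trans (sum_congr rfl fun γ hγ => ?_) (key.trans <|
      congrArg _ (sum_congr rfl fun δ hδ => ?_))
    · obtain ⟨-, h, v⟩ := mem_filter.1 hγ
      have hγ0 (i : ℕ) (hi : N + 1 ≤ i) : γ.rowLen i = 0 := by
        have := (isHorizontalStrip_iff_rowLen.1 h (i - 1)).2
        rw [Nat.sub_add_cancel (by omega), hα _ (by omega)] at this
        omega
      rw [card_sub_card h.1 hγ0, card_sub_card v.1 hγ0, prod_mul_distrib, prod_pow_eq_pow_sum,
        prod_pow_eq_pow_sum]
    · obtain ⟨-, h, v⟩ := mem_filter.1 hδ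
      rw [card_sub_card h.1 hβ', card_sub_card v.1 hα', prod_mul_distrib, prod_pow_eq_pow_sum,
        prod_pow_eq_pow_sum]
  · intro i _ c hc c' hc'
    exact (mem_filter.1 hc').2.2.trans (mem_filter.1 hc).2.1
  · intro δ
    rw [mem_filter, and_iff_right_of_imp fun h => hB' δ h.1 h.2, isHorizontalStrip_iff_rowLen,
      isVerticalStrip_iff_rowLen]
    simp only [mem_filter, mem_insert, mem_singleton]
    refine ⟨fun ⟨h, v⟩ => ⟨fun i _ => ?_, fun i hi => ?_⟩,
      fun ⟨h, h'⟩ => ⟨fun i => ?_, fun i => ?_⟩⟩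
    · have := h i; have := v i; omega
    · have := (h i).1; have := hβ' i hi; omega
    · rcases lt_or_ge i (N + 1) with hi | hi
      · exact (h i hi).2.symm
      · have := h' i hi; have := hβ' (i + 1) (by omega); omega
    · rcases lt_or_ge i (N + 1) with hi | hi
      · have := h i hi; omega
      · have := h' i hi; have := hα' i hi; omega
  · intro i _ c hc c' hc'
    simp only [mem_filter] at hc hc'
    exact hc'.2.2.trans hc.2.1
  · intro γ
    rw [mem_filter, and_iff_right_of_imp fun h => hB γ h.1 h.2, isHorizontalStrip_iff_rowLen,
      isVerticalStrip_iff_rowLen]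
    simp only [mem_filter, mem_insert, mem_singleton]
    refine ⟨fun ⟨h, v⟩ => ⟨fun i _ => ?_, fun i hi => ?_⟩,
      fun ⟨h, h'⟩ => ⟨fun i => ⟨?_, ?_⟩, fun i => ?_⟩⟩
    · refine ⟨by have := v i; omega, (h i).1, ?_⟩
      cases i with
      | zero => have := (v 0).2; omega
      | succ i => exact (h i).2
    · have := (h (i - 1)).2
      rw [Nat.sub_add_cancel (by omega), hα _ (by omega)] at this
      omega
    · rcases lt_or_ge i (N + 1) with hi | hi
      · exact (h i hi).2.1
      · have := hα' i hi; omega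
    · rcases lt_or_ge (i + 1) (N + 1) with hi | hi
      · exact (h (i + 1) hi).2.2
      · have := h' (i + 1) hi; omega
    · rcases lt_or_ge i (N + 1) with hi | hi
      · have := h i hi; omega
      · have := h' i hi; have := hβ' i hi; omega

end YoungDiagram

namespace SemistandardYoungTableau

theorem le_entry {γ : YoungDiagram} (T : SemistandardYoungTableau γ) {i j : ℕ}
    (h : (i, j) ∈ γ) : i ≤ T i j := by
  induction i with
  | zero => exact Nat.zero_le _
  | succ i ih =>
    exact (ih (γ.up_left_mem i.le_succ le_rfl h)).trans_lt (T.col_strict i.lt_succ_self h)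

/-- The diagram of the cells of a tableau whose entries are less than `p`. -/
def below {γ : YoungDiagram} (T : SemistandardYoungTableau γ) (p : ℕ) : YoungDiagram where
  cells := γ.cells.filter fun c => T c.1 c.2 < p
  isLowerSet := by
    rintro ⟨i, j⟩ ⟨i', j'⟩ hle hc
    obtain ⟨hi, hj⟩ := Prod.mk_le_mk.1 hle
    simp only [coe_filter, Set.mem_ofPred_eq, YoungDiagram.mem_cells] at hc ⊢
    have h := γ.up_left_mem hi le_rfl hc.1
    exact ⟨γ.up_left_mem le_rfl hj h,
      ((T.row_weak_of_le hj h).trans (T.col_weak hi hc.1)).trans_lt hc.2⟩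

theorem mem_below {γ : YoungDiagram} {T : SemistandardYoungTableau γ} {p i j : ℕ} :
    (i, j) ∈ T.below p ↔ (i, j) ∈ γ ∧ T i j < p :=
  mem_filter

/-- Restriction of a tableau to a smaller diagram. -/
def restrict {γ : YoungDiagram} (T : SemistandardYoungTableau γ) {δ : YoungDiagram} (hδ : δ ≤ γ) :
    SemistandardYoungTableau δ where
  entry i j := if (i, j) ∈ δ then T i j else 0
  row_weak' hj h := by
    rw [if_pos h, if_pos (δ.up_left_mem le_rfl hj.le h)]
    exact T.row_weak hj (hδ h)
  col_strict' hi h := by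
    rw [if_pos h, if_pos (δ.up_left_mem hi.le le_rfl h)]
    exact T.col_strict hi (hδ h)
  zeros' h := if_neg h

theorem restrict_apply {γ : YoungDiagram} (T : SemistandardYoungTableau γ) {δ : YoungDiagram}
    (hδ : δ ≤ γ) (i j : ℕ) : T.restrict hδ i j = if (i, j) ∈ δ then T i j else 0 :=
  rfl

/-- Extension of a tableau with entries less than `p` by a horizontal strip of entries `p`. -/
def extend {δ γ : YoungDiagram} (S : SemistandardYoungTableau δ) {p : ℕ}
    (hS : ∀ i j, (i, j) ∈ δ → S i j < p) (h : δ.IsHorizontalStrip γ) :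
    SemistandardYoungTableau γ where
  entry i j := if (i, j) ∈ δ then S i j else if (i, j) ∈ γ then p else 0
  row_weak' {i j₁ j₂} hj hc := by
    by_cases h₂ : (i, j₂) ∈ δ
    · rw [if_pos h₂, if_pos (δ.up_left_mem le_rfl hj.le h₂)]
      exact S.row_weak hj h₂
    · rw [if_neg h₂, if_pos hc]
      split_ifs with h₁
      exacts [(hS _ _ h₁).le, le_rfl, Nat.zero_le _]
  col_strict' {i₁ i₂ j} hi hc := by
    obtain ⟨i, rfl⟩ := Nat.exists_eq_add_of_lt hi
    have h₁ : (i₁, j) ∈ δ := δ.up_left_mem (Nat.le_add_right i₁ i) le_rfl (h.2 _ _ hc)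
    rw [if_pos h₁]
    split_ifs with h₂
    exacts [S.col_strict hi h₂, hS _ _ h₁]
  zeros' hc := by rw [if_neg fun h' => hc (h.1 h'), if_neg hc]

theorem extend_apply {δ γ : YoungDiagram} (S : SemistandardYoungTableau δ) {p : ℕ}
    (hS : ∀ i j, (i, j) ∈ δ → S i j < p) (h : δ.IsHorizontalStrip γ) (i j : ℕ) :
    S.extend hS h i j = if (i, j) ∈ δ then S i j else if (i, j) ∈ γ then p else 0 :=
  rfl

/-- Semistandard tableaux with entries less than `p`. -/
abbrev Bounded (p : ℕ) (γ : YoungDiagram) : Type :=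
  {T : SemistandardYoungTableau γ // ∀ i j, (i, j) ∈ γ → T i j < p}

instance (p : ℕ) (γ : YoungDiagram) : Finite (Bounded p γ) := by
  refine Finite.of_injective (β := γ.cells → Fin p)
    (fun T c => ⟨T.1 c.1.1 c.1.2, T.2 _ _ c.2⟩) fun T T' h => Subtype.ext <| ext fun i j => ?_
  by_cases hc : (i, j) ∈ γ
  · exact congrArg Fin.val (congrFun h ⟨(i, j), hc⟩)
  · rw [T.1.zeros hc, T'.1.zeros hc]

noncomputable instance (p : ℕ) (γ : YoungDiagram) : Fintype (Bounded p γ) :=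
  Fintype.ofFinite _

theorem Bounded.colLen_le {p : ℕ} {γ : YoungDiagram} (T : Bounded p γ) : γ.colLen 0 ≤ p := by
  by_contra! h
  have hc := YoungDiagram.mem_iff_lt_colLen.2 h
  exact ((T.1.le_entry hc).trans_lt (T.2 _ _ hc)).false

theorem Bounded.isHorizontalStrip_below {p : ℕ} {γ : YoungDiagram} (T : Bounded (p + 1) γ) :
    (T.1.below p).IsHorizontalStrip γ := by
  refine ⟨filter_subset _ _, fun i j hc => mem_below.2 ⟨γ.up_left_mem i.le_succ le_rfl hc, ?_⟩⟩
  exact (T.1.col_strict i.lt_succ_self hc).trans_le (Nat.lt_succ_iff.1 (T.2 _ _ hc))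

theorem below_extend {δ γ : YoungDiagram} (S : SemistandardYoungTableau δ) {p : ℕ}
    (hS : ∀ i j, (i, j) ∈ δ → S i j < p) (h : δ.IsHorizontalStrip γ) :
    (S.extend hS h).below p = δ := by
  refine SetLike.ext fun ⟨i, j⟩ => ?_
  rw [mem_below, extend_apply]
  by_cases hc : (i, j) ∈ δ
  · simp [hc, h.1 hc, hS]
  · by_cases hc' : (i, j) ∈ γ <;> simp [hc, hc']

/-- The Schur polynomial of the diagram `γ` in the variables `y 0, …, y (p - 1)`. -/
noncomputable def schur {R : Type*} [CommSemiring R] (p : ℕ) (y : ℕ → R) (γ : YoungDiagram) : R :=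
  ∑ T : Bounded p γ, ∏ c ∈ γ.cells, y (T.1 c.1 c.2)

theorem schur_bot {R : Type*} [CommSemiring R] (p : ℕ) (y : ℕ → R) : schur p y ⊥ = 1 := by
  have : Unique (Bounded p ⊥) :=
    { default := ⟨highestWeight ⊥, fun _ _ h => absurd h (YoungDiagram.notMem_bot _)⟩
      uniq := fun T => Subtype.ext <| ext fun i j => by
        rw [T.1.zeros (YoungDiagram.notMem_bot _), zeros _ (YoungDiagram.notMem_bot _)] }
  simp [schur]

theorem schur_eq_zero {R : Type*} [CommSemiring R] {p : ℕ} (y : ℕ → R) {γ : YoungDiagram}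
    (h : p < γ.colLen 0) : schur p y γ = 0 := by
  have : IsEmpty (Bounded p γ) := ⟨fun T => (T.colLen_le.trans_lt h).false⟩
  exact Fintype.sum_empty _

theorem schur_zero {R : Type*} [CommSemiring R] (y : ℕ → R) (γ : YoungDiagram) :
    schur 0 y γ = if γ = ⊥ then 1 else 0 := by
  split_ifs with h
  · rw [h, schur_bot]
  · refine schur_eq_zero y (Nat.pos_of_ne_zero fun h0 => h ?_)
    refine le_bot_iff.1 fun c hc => ?_
    have := YoungDiagram.mem_iff_lt_colLen.1 (γ.up_left_mem c.1.zero_le c.2.zero_le hc)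
    omega

theorem schur_succ {R : Type*} [CommSemiring R] (p : ℕ) (y : ℕ → R) (γ : YoungDiagram)
    {B : Finset YoungDiagram} (hB : ∀ δ, δ.IsHorizontalStrip γ → δ.colLen 0 ≤ p → δ ∈ B) :
    schur (p + 1) y γ = ∑ δ ∈ B with δ.IsHorizontalStrip γ,
      y p ^ (γ.card - δ.card) * schur p y δ := by
  have hmaps : ∀ T ∈ (univ : Finset (Bounded (p + 1) γ)),
      T.1.below p ∈ B.filter (·.IsHorizontalStrip γ) := fun T _ => by
    have h := T.isHorizontalStrip_below
    refine mem_filter.2 ⟨hB _ h ?_, h⟩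
    refine Bounded.colLen_le ⟨T.1.restrict h.1, fun i j hc => ?_⟩
    rw [restrict_apply, if_pos hc]
    exact (mem_below.1 hc).2
  rw [schur, ← sum_fiberwise_of_maps_to hmaps]
  refine sum_congr rfl fun δ hδ => ?_
  have h := (mem_filter.1 hδ).2
  rw [schur, mul_sum]
  have hlt (T : Bounded (p + 1) γ) (hT : T.1.below p = δ) (i j : ℕ) (hc : (i, j) ∈ δ) :
      T.1.restrict h.1 i j < p := by
    rw [restrict_apply, if_pos hc]
    rw [← hT] at hc
    exact (mem_below.1 hc).2
  have heq (T : Bounded (p + 1) γ) (hT : T.1.below p = δ) (i j : ℕ) (hc : (i, j) ∈ γ)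
      (hc' : (i, j) ∉ δ) : T.1 i j = p := by
    rw [← hT, mem_below] at hc'
    have := T.2 i j hc
    have : ¬ T.1 i j < p := fun h => hc' ⟨hc, h⟩
    omega
  refine sum_bij' (fun T hT => ⟨T.1.restrict h.1, hlt T (mem_filter.1 hT).2⟩)
    (fun S _ => ⟨S.1.extend S.2 h, fun i j hc => ?_⟩) (fun _ _ => mem_univ _)
    (fun S _ => mem_filter.2 ⟨mem_univ _, below_extend S.1 S.2 h⟩) ?_ ?_ ?_
  · rw [extend_apply]
    split_ifs with hc'
    exacts [(S.2 _ _ hc').trans p.lt_succ_self, p.lt_succ_self]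
  · intro T hT
    refine Subtype.ext <| ext fun i j => ?_
    simp only [extend_apply, restrict_apply]
    split_ifs with hc hc'
    exacts [rfl, (heq T (mem_filter.1 hT).2 i j hc' hc).symm, (T.1.zeros hc').symm]
  · intro S _
    refine Subtype.ext <| ext fun i j => ?_
    simp only [extend_apply, restrict_apply]
    split_ifs with hc
    exacts [rfl, (S.1.zeros hc).symm]
  · intro T hT
    rw [← prod_sdiff (YoungDiagram.cells_subset_iff.2 h.1), YoungDiagram.card, YoungDiagram.card,
      ← card_sdiff_of_subset (YoungDiagram.cells_subset_iff.2 h.1)]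
    congr 1
    · refine prod_eq_pow_card fun c hc => ?_
      obtain ⟨hc, hc'⟩ := mem_sdiff.1 hc
      rw [heq T (mem_filter.1 hT).2 _ _ hc hc']
    · refine prod_congr rfl fun c hc => ?_
      rw [restrict_apply, if_pos (YoungDiagram.mem_cells c |>.1 hc)]

theorem schur_transpose_succ {R : Type*} [CommSemiring R] (q : ℕ) (y : ℕ → R) (γ : YoungDiagram)
    {B : Finset YoungDiagram} (hB : ∀ β, β.IsVerticalStrip γ → β.rowLen 0 ≤ q → β ∈ B) :
    schur (q + 1) y γ.transpose = ∑ β ∈ B with β.IsVerticalStrip γ,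
      y q ^ (γ.card - β.card) * schur q y β.transpose := by
  have hcard (γ : YoungDiagram) : γ.transpose.card = γ.card := by
    simp [YoungDiagram.card, YoungDiagram.transpose]
  rw [schur_succ q y γ.transpose (B := B.image YoungDiagram.transpose) fun δ h hδ => ?_]
  · rw [filter_image, sum_image fun β _ β' _ h => YoungDiagram.transpose_eq_iff.1 h]
    simp only [YoungDiagram.isHorizontalStrip_transpose, hcard]
  · refine mem_image.2 ⟨δ.transpose, hB _ ?_ ?_, δ.transpose_transpose⟩
    · rwa [← YoungDiagram.isHorizontalStrip_transpose, δ.transpose_transpose]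
    · rwa [δ.rowLen_transpose]

end SemistandardYoungTableau

namespace YoungDiagram

theorem finite_setOf_fits (r c : ℕ) : {γ : YoungDiagram | γ.cells ⊆ range r ×ˢ range c}.Finite :=
  Set.Finite.of_finite_image ((range r ×ˢ range c).powerset.finite_toSet.subset <| by
    rintro _ ⟨γ, hγ, rfl⟩
    exact mem_powerset.2 hγ) fun _ _ _ _ h => YoungDiagram.ext h

/-- The diagrams with at most `r` rows and at most `c` columns. -/
noncomputable def box (r c : ℕ) : Finset YoungDiagram :=
  (finite_setOf_fits r c).toFinset

theorem mem_box {r c : ℕ} {γ : YoungDiagram} : γ ∈ box r c ↔ γ.colLen 0 ≤ r ∧ γ.rowLen 0 ≤ c := by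
  rw [box, Set.Finite.mem_toFinset]
  constructor
  · refine fun h => ⟨?_, ?_⟩ <;> by_contra! hlt
    · simpa using h (mem_iff_lt_colLen.2 hlt)
    · simpa using h (mem_iff_lt_rowLen.2 hlt)
  · rintro ⟨hr, hc⟩ ⟨i, j⟩ h
    exact mem_product.2
      ⟨mem_range.2 ((mem_iff_lt_colLen.1 (γ.up_left_mem le_rfl j.zero_le h)).trans_le hr),
        mem_range.2 ((mem_iff_lt_rowLen.1 (γ.up_left_mem i.zero_le le_rfl h)).trans_le hc)⟩

theorem box_zero_right (r : ℕ) : box r 0 = {⊥} := by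
  ext γ
  rw [mem_box, mem_singleton]
  constructor
  · rintro ⟨-, h⟩
    refine ext_rowLen fun i => ?_
    have := γ.rowLen_anti 0 i i.zero_le
    have := (⊥ : YoungDiagram).rowLen_anti 0 i i.zero_le
    have : ¬ 0 < (⊥ : YoungDiagram).rowLen 0 := fun h => notMem_bot _ (mem_iff_lt_rowLen.2 h)
    omega
  · rintro rfl
    refine ⟨?_, ?_⟩ <;> by_contra! hlt
    · exact notMem_bot _ (mem_iff_lt_colLen.2 ((Nat.zero_le _).trans_lt hlt))
    · exact notMem_bot _ (mem_iff_lt_rowLen.2 hlt)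

theorem colLen_le_colLen {δ γ : YoungDiagram} (h : δ ≤ γ) (j : ℕ) : δ.colLen j ≤ γ.colLen j := by
  rw [← rowLen_transpose, ← rowLen_transpose]
  exact le_iff_rowLen_le.1 (transpose_le_iff.2 h) j

theorem IsHorizontalStrip.colLen_le {δ γ : YoungDiagram} (h : δ.IsHorizontalStrip γ) :
    γ.colLen 0 ≤ δ.colLen 0 + 1 := by
  by_contra! hlt
  exact absurd (mem_iff_lt_colLen.1 (h.2 _ _ (mem_iff_lt_colLen.2 hlt))) (lt_irrefl _)

end YoungDiagram

namespace SemistandardYoungTableau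

open YoungDiagram

/-- Multiplying a conjugate Schur polynomial by the generating polynomial of the elementary
symmetric polynomials adds horizontal strips. -/
theorem sum_isHorizontalStrip_schur_transpose {R : Type*} [CommSemiring R] (x : R) (y : ℕ → R)
    {q r : ℕ} {α : YoungDiagram} (hα : α.colLen 0 ≤ r) :
    ∑ γ ∈ box (r + 1) q with α.IsHorizontalStrip γ,
        x ^ (γ.card - α.card) * schur q y γ.transpose =
      (∏ j ∈ range q, (1 + x * y j)) * schur q y α.transpose := by
  induction q generalizing r α with
  | zero =>
    have hbot (γ : YoungDiagram) : γ.transpose = ⊥ ↔ γ = ⊥ := by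
      rw [transpose_eq_iff_eq_transpose]
      rfl
    rw [box_zero_right, filter_singleton, prod_range_zero, one_mul, schur_zero, hbot]
    have : α.IsHorizontalStrip ⊥ ↔ α = ⊥ :=
      ⟨fun h => le_bot_iff.1 h.1, fun h => ⟨h.le, fun _ _ hc => absurd hc (notMem_bot _)⟩⟩
    split_ifs with h h' h'
    · rw [sum_singleton, (hbot ⊥).2 rfl, schur_bot, h']
      simp
    · exact absurd (this.1 h) h'
    · exact absurd (this.2 h') h
    · exact sum_empty
  | succ q ih =>
    calc
      _ = ∑ γ ∈ box (r + 1) (q + 1) with α.IsHorizontalStrip γ,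
          ∑ β ∈ box (r + 1) q with β.IsVerticalStrip γ,
            x ^ (γ.card - α.card) * y q ^ (γ.card - β.card) * schur q y β.transpose := by
        refine sum_congr rfl fun γ hγ => ?_
        rw [schur_transpose_succ q y γ (B := box (r + 1) q), mul_sum]
        · exact sum_congr rfl fun β _ => (mul_assoc _ _ _).symm
        · exact fun β h hβ => mem_box.2
            ⟨(colLen_le_colLen h.1 0).trans (mem_box.1 (mem_filter.1 hγ).1).1, hβ⟩
      _ = ∑ β ∈ box (r + 1) q,
          (∑ γ ∈ box (r + 1) (q + 1) with α.IsHorizontalStrip γ ∧ β.IsVerticalStrip γ,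
            x ^ (γ.card - α.card) * y q ^ (γ.card - β.card)) * schur q y β.transpose := by
        simp only [sum_mul]
        exact sum_comm' fun γ β => by simp only [mem_filter]; tauto
      _ = ∑ β ∈ box (r + 1) q, ((1 + x * y q) *
          ∑ δ ∈ box r q with δ.IsHorizontalStrip β ∧ δ.IsVerticalStrip α,
            x ^ (β.card - δ.card) * y q ^ (α.card - δ.card)) * schur q y β.transpose := by
        refine sum_congr rfl fun β hβ => ?_
        rw [sum_strips_comm x (y q) (B' := box r q)]
        · exact fun γ h v => mem_box.2 ⟨h.colLen_le.trans (Nat.succ_le_succ hα),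
            (isVerticalStrip_iff_rowLen.1 v 0).2.trans (Nat.succ_le_succ (mem_box.1 hβ).2)⟩
        · exact fun δ h v => mem_box.2 ⟨(colLen_le_colLen v.1 0).trans hα,
            (le_iff_rowLen_le.1 h.1 0).trans (mem_box.1 hβ).2⟩
      _ = (1 + x * y q) * ∑ δ ∈ box r q with δ.IsVerticalStrip α, y q ^ (α.card - δ.card) *
          ∑ β ∈ box (r + 1) q with δ.IsHorizontalStrip β,
            x ^ (β.card - δ.card) * schur q y β.transpose := by
        simp only [mul_assoc, ← mul_sum, sum_mul]
        simp only [mul_sum]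
        rw [sum_comm' (t' := (box r q).filter (·.IsVerticalStrip α))
          (s' := fun δ => (box (r + 1) q).filter (δ.IsHorizontalStrip ·))
          fun β δ => by simp only [mem_filter]; tauto]
        exact sum_congr rfl fun δ _ => sum_congr rfl fun β _ => by ring
      _ = _ := by
        rw [schur_transpose_succ q y α (B := box r q), prod_range_succ, mul_comm _ (1 + x * y q),
          mul_assoc]
        · refine congrArg _ ((sum_congr rfl fun δ hδ => ?_).trans (mul_sum _ _ _).symm)
          rw [ih (mem_box.1 (mem_filter.1 hδ).1).1, mul_left_comm]
        · exact fun δ v hδ => mem_box.2 ⟨(colLen_le_colLen v.1 0).trans hα, hδ⟩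

/-- The dual Cauchy identity. -/
theorem sum_schur_mul_schur_transpose {R : Type*} [CommSemiring R] (x y : ℕ → R) (p q : ℕ) :
    ∑ σ ∈ box p q, schur p x σ * schur q y σ.transpose =
      ∏ i ∈ range p, ∏ j ∈ range q, (1 + x i * y j) := by
  induction p with
  | zero =>
    have hbot : (⊥ : YoungDiagram) ∈ box 0 q := by
      have h : (⊥ : YoungDiagram) ∈ box 0 0 := by rw [box_zero_right]; exact mem_singleton_self _
      exact mem_box.2 ⟨(mem_box.1 h).1, (mem_box.1 h).2.trans q.zero_le⟩
    have htr : (⊥ : YoungDiagram).transpose = ⊥ := rfl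
    simp [schur_zero, hbot, htr, schur_bot]
  | succ p ih =>
    calc
      _ = ∑ σ ∈ box (p + 1) q, ∑ δ ∈ box p q with δ.IsHorizontalStrip σ,
          schur p x δ * (x p ^ (σ.card - δ.card) * schur q y σ.transpose) := by
        refine sum_congr rfl fun σ hσ => ?_
        rw [schur_succ p x σ (B := box p q), sum_mul]
        · exact sum_congr rfl fun δ _ => by ring
        · exact fun δ h hδ => mem_box.2
            ⟨hδ, (le_iff_rowLen_le.1 h.1 0).trans (mem_box.1 hσ).2⟩
      _ = ∑ δ ∈ box p q, schur p x δ * ∑ σ ∈ box (p + 1) q with δ.IsHorizontalStrip σ,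
          x p ^ (σ.card - δ.card) * schur q y σ.transpose := by
        simp only [mul_sum]
        exact sum_comm' fun σ δ => by simp only [mem_filter]; tauto
      _ = _ := by
        rw [prod_range_succ, ← ih, sum_mul]
        refine sum_congr rfl fun δ hδ => ?_
        rw [sum_isHorizontalStrip_schur_transpose (x p) y (mem_box.1 hδ).1]
        ring

end SemistandardYoungTableau

section Content

variable {κ τ : Type*} (s : Finset κ) (f : κ → τ)

theorem MvPolynomial.prod_X_eq_monomial {R : Type*} [CommSemiring R] :
    ∏ c ∈ s, (X (f c) : MvPolynomial τ R) = monomial (∑ c ∈ s, Finsupp.single (f c) 1) 1 :=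
  (monomial_sum_one _ _).symm

theorem Finsupp.sum_single_one_apply (k : τ) :
    (∑ c ∈ s, Finsupp.single (f c) 1) k = #{c ∈ s | f c = k} := by
  rw [Finsupp.finsetSum_apply, card_filter]
  exact Finset.sum_congr rfl fun c _ => Finsupp.single_apply

end Content

/-- Coefficients of products of monomials in two sets of variables. -/
theorem MvPolynomial.coeff_prod_X_mul_prod_X {κ κ' : Type*} (s : Finset κ) (f : κ → ℕ)
    (s' : Finset κ') (f' : κ' → ℕ) (d d' : ℕ →₀ ℕ) :
    coeff (Finsupp.sumElim d d')
        ((∏ c ∈ s, (X (Sum.inl (f c)) : MvPolynomial (ℕ ⊕ ℕ) ℕ)) * ∏ c ∈ s', X (Sum.inr (f' c))) =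
      (if ∀ k, #{c ∈ s | f c = k} = d k then 1 else 0) *
        if ∀ k, #{c ∈ s' | f' c = k} = d' k then 1 else 0 := by
  rw [prod_X_eq_monomial s fun c => (Sum.inl (f c) : ℕ ⊕ ℕ),
    prod_X_eq_monomial s' fun c => (Sum.inr (f' c) : ℕ ⊕ ℕ), monomial_mul, mul_one, coeff_monomial,
    ite_zero_mul_ite_zero, mul_one]
  refine if_congr ?_ rfl rfl
  rw [Finsupp.ext_iff, Sum.forall]
  simp [Finsupp.sum_single_one_apply, -Finsupp.coe_finsetSum]

/-- The vector `l`, extended by zero, as a finitely supported function. -/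
noncomputable def extcFinsupp {p : ℕ} (l : Fin p → ℕ) : ℕ →₀ ℕ :=
  Finsupp.onFinset (range p) (extc l) fun i hi => by
    rw [mem_range]
    by_contra h
    exact hi (dif_neg h)

theorem extcFinsupp_apply {p : ℕ} (l : Fin p → ℕ) (k : ℕ) : extcFinsupp l k = extc l k :=
  rfl

theorem lt_of_extc_ne_zero {p : ℕ} {l : Fin p → ℕ} {k : ℕ} (h : extc l k ≠ 0) : k < p := by
  by_contra hk
  exact h (dif_neg hk)

theorem forall_card_eq_extc_iff {κ : Type*} {p : ℕ} (l : Fin p → ℕ) (s : Finset κ)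
    (f : κ → Fin p) :
    (∀ k, #{c ∈ s | (f c : ℕ) = k} = extc l k) ↔ ∀ i, #{c ∈ s | f c = i} = l i := by
  constructor
  · intro h i
    simpa [extc, Fin.val_inj] using h i
  · intro h k
    by_cases hk : k < p
    · simpa [extc, hk, Fin.ext_iff] using h ⟨k, hk⟩
    · rw [extc, dif_neg hk, card_eq_zero, filter_eq_empty_iff]
      exact fun c _ hc => hk (hc ▸ (f c).2)

theorem card_binary_matrices {p q : ℕ} (l : Fin p → ℕ) (m : Fin q → ℕ) :
    Nat.card {A : Fin p → Fin q → ℕ // (∀ i j, A i j ≤ 1) ∧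
        (∀ i, ∑ j, A i j = l i) ∧ (∀ j, ∑ i, A i j = m j)} =
      #{S : Finset (Fin p × Fin q) |
        (∀ i, #{c ∈ S | c.1 = i} = l i) ∧ ∀ j, #{c ∈ S | c.2 = j} = m j} := by
  have hrow (S : Finset (Fin p × Fin q)) (i : Fin p) :
      #{c ∈ S | c.1 = i} = ∑ j, if (i, j) ∈ S then 1 else 0 := by
    rw [← card_filter]
    refine (card_bij (fun j _ => (i, j)) ?_ ?_ ?_).symm
    · simp
    · simp
    · rintro ⟨i', j⟩ h
      obtain ⟨h, rfl⟩ := mem_filter.1 h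
      exact ⟨j, by simpa using h, rfl⟩
  have hcol (S : Finset (Fin p × Fin q)) (j : Fin q) :
      #{c ∈ S | c.2 = j} = ∑ i, if (i, j) ∈ S then 1 else 0 := by
    rw [← card_filter]
    refine (card_bij (fun i _ => (i, j)) ?_ ?_ ?_).symm
    · simp
    · simp
    · rintro ⟨i, j'⟩ h
      obtain ⟨h, rfl⟩ := mem_filter.1 h
      exact ⟨i, by simpa using h, rfl⟩
  have hA (A : Fin p → Fin q → ℕ) (h : ∀ i j, A i j ≤ 1) (i : Fin p) (j : Fin q) :
      (if (i, j) ∈ ({c | A c.1 c.2 = 1} : Finset (Fin p × Fin q)) then 1 else 0) = A i j := by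
    have := h i j
    simp only [mem_filter, mem_univ, true_and]
    split_ifs <;> omega
  rw [← Fintype.card_subtype, ← Nat.card_eq_fintype_card]
  exact Nat.card_congr
    { toFun := fun A => ⟨({c | A.1 c.1 c.2 = 1} : Finset (Fin p × Fin q)),
        fun i => by simpa only [hrow, hA A.1 A.2.1] using A.2.2.1 i,
        fun j => by simpa only [hcol, hA A.1 A.2.1] using A.2.2.2 j⟩
      invFun := fun S => ⟨fun i j => if (i, j) ∈ S.1 then 1 else 0,
        fun i j => by dsimp only; split_ifs <;> omega,
        fun i => (hrow S.1 i).symm.trans (S.2.1 i), fun j => (hcol S.1 j).symm.trans (S.2.2 j)⟩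
      left_inv := fun A => Subtype.ext <| funext fun i => funext fun j => hA A.1 A.2.1 i j
      right_inv := fun S => Subtype.ext <| Finset.ext fun c => by simp }

theorem coeff_prod_one_add {p q : ℕ} (l : Fin p → ℕ) (m : Fin q → ℕ) :
    MvPolynomial.coeff (Finsupp.sumElim (extcFinsupp l) (extcFinsupp m))
        (∏ i ∈ range p, ∏ j ∈ range q,
          (1 + MvPolynomial.X (Sum.inl i) * MvPolynomial.X (Sum.inr j) :
            MvPolynomial (ℕ ⊕ ℕ) ℕ)) =
      #{S : Finset (Fin p × Fin q) |
        (∀ i, #{c ∈ S | c.1 = i} = l i) ∧ ∀ j, #{c ∈ S | c.2 = j} = m j} := by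
  simp only [prod_range]
  rw [← Fintype.prod_prod_type', prod_one_add, powerset_univ, MvPolynomial.coeff_sum, card_filter]
  refine sum_congr rfl fun S _ => ?_
  rw [prod_mul_distrib, MvPolynomial.coeff_prod_X_mul_prod_X S (fun c => (c.1 : ℕ)) S
    (fun c => (c.2 : ℕ)), ite_zero_mul_ite_zero, mul_one]
  simp only [extcFinsupp_apply, forall_card_eq_extc_iff]

namespace SemistandardYoungTableau

theorem skewContent_rowLen (γ : YoungDiagram) (T : ℕ → ℕ → ℕ) (k : ℕ) :
    skewContent γ.rowLen (fun _ => 0) T k = #{c ∈ γ.cells | T c.1 c.2 = k} := by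
  rw [skewContent]
  refine Nat.subtype_card _ fun c => ?_
  simp [YoungDiagram.mem_iff_lt_rowLen (i := c.1) (j := c.2)]

theorem kostka_rowLen {p : ℕ} (l : Fin p → ℕ) (γ : YoungDiagram) :
    kostka γ.rowLen (extc l) =
      #{T : Bounded p γ | ∀ k, #{c ∈ γ.cells | T.1 c.1 c.2 = k} = extc l k} := by
  simp only [kostka, skewContent_rowLen]
  rw [← Fintype.card_subtype, ← Nat.card_eq_fintype_card]
  exact Nat.card_congr
    { toFun := fun T => ⟨⟨
        { entry := T.1
          row_weak' := fun hj h => T.2.1.2.1 _ _ _ hj.le (YoungDiagram.mem_iff_lt_rowLen.1 h)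
          col_strict' := fun hi h => T.2.1.2.2 _ _ _ hi (YoungDiagram.mem_iff_lt_rowLen.1 h)
          zeros' := fun h => T.2.1.1 _ _ (not_lt.1 (mt YoungDiagram.mem_iff_lt_rowLen.2 h)) },
        fun i j h => lt_of_extc_ne_zero (l := l) <| by
          rw [← T.2.2]
          exact card_ne_zero_of_mem (mem_filter.2 ⟨h, rfl⟩)⟩, T.2.2⟩
      invFun := fun T => ⟨T.1.1,
        ⟨fun i j h => T.1.1.zeros (mt YoungDiagram.mem_iff_lt_rowLen.1 h.not_gt),
          fun i j₁ j₂ hj h => T.1.1.row_weak_of_le hj (YoungDiagram.mem_iff_lt_rowLen.2 h),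
          fun i₁ i₂ j hi h => T.1.1.col_strict hi (YoungDiagram.mem_iff_lt_rowLen.2 h)⟩, T.2⟩
      left_inv := fun T => rfl
      right_inv := fun T => rfl }

theorem coeff_schur_mul_schur {p q : ℕ} (l : Fin p → ℕ) (m : Fin q → ℕ) (γ γ' : YoungDiagram) :
    MvPolynomial.coeff (Finsupp.sumElim (extcFinsupp l) (extcFinsupp m))
        (schur p (fun i => (MvPolynomial.X (Sum.inl i) : MvPolynomial (ℕ ⊕ ℕ) ℕ)) γ *
          schur q (fun j => MvPolynomial.X (Sum.inr j)) γ') =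
      kostka γ.rowLen (extc l) * kostka γ'.rowLen (extc m) := by
  rw [schur, schur, sum_mul_sum, MvPolynomial.coeff_sum, kostka_rowLen, kostka_rowLen, card_filter,
    card_filter, sum_mul_sum]
  refine sum_congr rfl fun T _ => ?_
  rw [MvPolynomial.coeff_sum]
  refine sum_congr rfl fun T' _ => ?_
  rw [MvPolynomial.coeff_prod_X_mul_prod_X]
  rfl

theorem card_binary_matrices_eq_sum_box {p q : ℕ} (l : Fin p → ℕ) (m : Fin q → ℕ) :
    Nat.card {A : Fin p → Fin q → ℕ // (∀ i j, A i j ≤ 1) ∧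
        (∀ i, ∑ j, A i j = l i) ∧ (∀ j, ∑ i, A i j = m j)} =
      ∑ σ ∈ YoungDiagram.box p q,
        kostka σ.rowLen (extc l) * kostka σ.transpose.rowLen (extc m) := by
  rw [card_binary_matrices, ← coeff_prod_one_add, ← sum_schur_mul_schur_transpose,
    MvPolynomial.coeff_sum]
  exact sum_congr rfl fun σ _ => coeff_schur_mul_schur l m σ σ.transpose

theorem kostka_rowLen_eq_zero {p : ℕ} (l : Fin p → ℕ) {γ : YoungDiagram} (h : p < γ.colLen 0) :
    kostka γ.rowLen (extc l) = 0 := by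
  rw [kostka_rowLen, card_eq_zero, filter_eq_empty_iff]
  exact fun T _ => absurd T.colLen_le h.not_ge

theorem kostka_rowLen_eq_zero_of_card_ne {p : ℕ} (l : Fin p → ℕ) {γ : YoungDiagram}
    (h : γ.card ≠ ∑ i, l i) : kostka γ.rowLen (extc l) = 0 := by
  rw [kostka_rowLen, card_eq_zero, filter_eq_empty_iff]
  refine fun T _ hT => h ?_
  rw [YoungDiagram.card, card_eq_sum_card_fiberwise (t := range p)
    fun c hc => mem_coe.2 (mem_range.2 (T.2 c.1 c.2 hc)), sum_range]
  exact sum_congr rfl fun i _ => (hT i).trans (dif_pos i.2)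

end SemistandardYoungTableau

namespace YoungDiagram

theorem sum_rowLens (γ : YoungDiagram) : γ.rowLens.sum = γ.card := by
  rw [card_eq_sum_rowLen γ fun i hi => rowLen_eq_zero_iff.2 hi]
  rfl

/-- The Young diagram of a partition. -/
def ofPartition {n : ℕ} (P : n.Partition) : YoungDiagram :=
  ofRowLens (P.parts.sort (· ≤ ·)).reverse
    (Multiset.pairwise_sort P.parts (· ≤ ·)).sortedLE.reverse

variable {n : ℕ} (P : n.Partition)

theorem rowLens_ofPartition : (ofPartition P).rowLens = (P.parts.sort (· ≤ ·)).reverse :=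
  rowLens_ofRowLens_eq_self fun x hx => P.parts_pos (by simpa using hx)

theorem rowLen_ofPartition : (ofPartition P).rowLen = pf P := by
  funext i
  rw [pf, ← rowLens_ofPartition]
  rcases lt_or_ge i (ofPartition P).rowLens.length with hi | hi
  · rw [List.getD_eq_getElem _ _ hi]
    exact (get_rowLens (h := hi)).symm
  · rw [List.getD_eq_default _ _ hi, rowLen_eq_zero_iff]
    rwa [length_rowLens] at hi

theorem card_ofPartition : (ofPartition P).card = n := by
  rw [← sum_rowLens, rowLens_ofPartition, List.sum_reverse, ← Multiset.sum_coe, Multiset.sort_eq,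
    P.parts_sum]

theorem rowLen_transpose_ofPartition : (ofPartition P).transpose.rowLen = conjFun n (pf P) := by
  funext j
  rw [rowLen_transpose, conjFun, ← rowLen_ofPartition, ← card_range ((ofPartition P).colLen j)]
  congr 1
  ext i
  rw [mem_range, mem_filter, mem_range, ← mem_iff_lt_rowLen, mem_iff_lt_colLen]
  refine (and_iff_right_of_imp fun h => h.trans_le ?_).symm
  rw [colLen_eq_card]
  exact (card_le_card (filter_subset _ _)).trans_eq (card_ofPartition P)

theorem ofPartition_injective : Function.Injective (ofPartition (n := n)) := by
  intro P Q h
  have := congrArg rowLens h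
  rw [rowLens_ofPartition, rowLens_ofPartition, List.reverse_inj] at this
  refine Nat.Partition.ext ?_
  rw [← Multiset.sort_eq P.parts (· ≤ ·), this, Multiset.sort_eq]

theorem exists_ofPartition_eq {γ : YoungDiagram} (h : γ.card = n) :
    ∃ P : n.Partition, ofPartition P = γ := by
  refine ⟨⟨γ.rowLens, fun hx => γ.pos_of_mem_rowLens _ (Multiset.mem_coe.1 hx), ?_⟩, ?_⟩
  · rw [Multiset.sum_coe, sum_rowLens, h]
  · refine equivListRowLens.injective (Subtype.ext ?_)
    refine (rowLens_ofPartition _).trans ?_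
    rw [List.reverse_eq_iff]
    refine List.Perm.eq_of_sortedLE (Multiset.pairwise_sort _ _).sortedLE γ.rowLens_sorted.reverse ?_
    rw [← Multiset.coe_eq_coe, Multiset.sort_eq, Multiset.coe_reverse]
    rfl

end YoungDiagram

/-- the number of `p × q` binary matrices with row sums `l` and column sums `m`
equals `∑_{σ ⊢ n} K_{σl} K_{σ'm}`. -/
theorem stmt3 (n p q : ℕ) (l : Fin p → ℕ) (m : Fin q → ℕ)
    (hl : ∑ i, l i = n) (hm : ∑ j, m j = n) :
    Nat.card {A : Fin p → Fin q → ℕ // (∀ i j, A i j ≤ 1) ∧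
        (∀ i, ∑ j, A i j = l i) ∧ (∀ j, ∑ i, A i j = m j)} =
      ∑ σ : n.Partition, kostka (pf σ) (extc l) * kostka (conjFun n (pf σ)) (extc m) := by
  rw [SemistandardYoungTableau.card_binary_matrices_eq_sum_box]
  simp only [← YoungDiagram.rowLen_transpose_ofPartition]
  simp only [← YoungDiagram.rowLen_ofPartition]
  rw [← sum_image (g := YoungDiagram.ofPartition)
    (f := fun σ => kostka σ.rowLen (extc l) * kostka σ.transpose.rowLen (extc m))
    fun P _ Q _ h => YoungDiagram.ofPartition_injective h]
  refine sum_congr_of_eq_on_inter (fun σ _ hσ => ?_) (fun σ _ hσ => ?_) fun _ _ _ => rfl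
  · rw [SemistandardYoungTableau.kostka_rowLen_eq_zero_of_card_ne, zero_mul]
    rw [hl]
    intro h
    obtain ⟨P, hP⟩ := YoungDiagram.exists_ofPartition_eq h
    exact hσ (mem_image.2 ⟨P, mem_univ _, hP⟩)
  · rw [YoungDiagram.mem_box, not_and_or, not_le, not_le] at hσ
    rcases hσ with h | h
    · rw [SemistandardYoungTableau.kostka_rowLen_eq_zero l h, zero_mul]
    · rw [← YoungDiagram.colLen_transpose] at h
      rw [SemistandardYoungTableau.kostka_rowLen_eq_zero m h, mul_zero]
end
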